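/- arXiv:2204.04255 — 2 statements merged into one kernel-verified Lean document; each statement's English description precedes it below -/
import Mathlib

section
/- (Birational Greene's Theorem) Let R = [r] × [s] and choose (i,j) ∈ R such that i = r or j = s. Then for any x ∈ ℝ_{>0}^R and every 1 ≤ k ≤ min{i,j}, the product ∏_{t=0}^{k−1} RSK(x)_{i−t, j−t} equals w_{[1,i] × [1,j]}^{(k)}(x), the total weight of all collections of k vertex-disjoint paths in [1,i] × [1,j] from (1,1),…,(1,k) to (i, j−k+1),…,(i,j). -/
namespace Paper

/-- Membership in the rectangle poset `R = [1,r] × [1,s]` (coordinates in `ℤ`). -/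
def inR (r s : ℕ) (p : ℤ × ℤ) : Prop :=
  1 ≤ p.1 ∧ p.1 ≤ (r : ℤ) ∧ 1 ≤ p.2 ∧ p.2 ≤ (s : ℤ)

instance (r s : ℕ) : DecidablePred (inR r s) := fun _ => by unfold inR; infer_instance

/-- The cover relation in the product of two chains. -/
def CoverStep (p q : ℤ × ℤ) : Prop :=
  (q.1 = p.1 + 1 ∧ q.2 = p.2) ∨ (q.1 = p.1 ∧ q.2 = p.2 + 1)

/-- Upper covers of `p` inside the rectangle. -/
def upSet (r s : ℕ) (p : ℤ × ℤ) : Finset (ℤ × ℤ) :=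
  ({(p.1 + 1, p.2), (p.1, p.2 + 1)} : Finset (ℤ × ℤ)).filter (inR r s)

/-- Lower covers of `p` inside the rectangle. -/
def downSet (r s : ℕ) (p : ℤ × ℤ) : Finset (ℤ × ℤ) :=
  ({(p.1 - 1, p.2), (p.1, p.2 - 1)} : Finset (ℤ × ℤ)).filter (inR r s)

/-- Sum of the labels of the lower covers of `p` (empty sum = 1). -/
noncomputable def dsum (r s : ℕ) (x : ℤ × ℤ → ℝ) (p : ℤ × ℤ) : ℝ :=
  if (downSet r s p).Nonempty then ∑ q ∈ downSet r s p, x q else 1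

/-- Parallel sum of the labels of the upper covers of `p` (empty parallel sum = 1). -/
noncomputable def usum (r s : ℕ) (x : ℤ × ℤ → ℝ) (p : ℤ × ℤ) : ℝ :=
  if (upSet r s p).Nonempty then (∑ q ∈ upSet r s p, (x q)⁻¹)⁻¹ else 1

/-- The birational toggle at `p`. -/
noncomputable def toggle (r s : ℕ) (p : ℤ × ℤ) (x : ℤ × ℤ → ℝ) : ℤ × ℤ → ℝ :=
  fun q => if q = p then usum r s x p * dsum r s x p / x p else x q

/-- The elements of `[1,a] × [1,b]` listed from top to bottom
(descending lexicographic order, the reverse of a linear extension). -/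
def rectList (a b : ℕ) : List (ℤ × ℤ) :=
  (List.range a).reverse.flatMap fun i =>
    (List.range b).reverse.map fun j => ((i : ℤ) + 1, (j : ℤ) + 1)

/-- Birational rowmotion on the rectangle: toggles from top to bottom. -/
noncomputable def rho (r s : ℕ) (x : ℤ × ℤ → ℝ) : ℤ × ℤ → ℝ :=
  (rectList r s).foldl (fun y p => toggle r s p y) x

/-- Inverse birational rowmotion: toggles from bottom to top. -/
noncomputable def rhoInv (r s : ℕ) (x : ℤ × ℤ → ℝ) : ℤ × ℤ → ℝ :=
  (rectList r s).reverse.foldl (fun y p => toggle r s p y) x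

/-- Integer powers of birational rowmotion. -/
noncomputable def rhoPow (r s : ℕ) (k : ℤ) (x : ℤ × ℤ → ℝ) : ℤ × ℤ → ℝ :=
  if 0 ≤ k then (rho r s)^[k.toNat] x else (rhoInv r s)^[(-k).toNat] x

/-- Saturated chains from `a` to `b`, as lists of successive cover steps. -/
def ChainList (a b : ℤ × ℤ) : Type :=
  {l : List (ℤ × ℤ) // l.Chain' CoverStep ∧ l.head? = some a ∧ l.getLast? = some b}

/-- The inverse birational transfer map on the rectangle: `φ⁻¹(x)_p` is the total weight
of all saturated chains from the minimal element `(1,1)` to `p`. -/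
noncomputable def phiInv (x : ℤ × ℤ → ℝ) : ℤ × ℤ → ℝ :=
  fun p => ∑ᶠ c : ChainList (1, 1) p, (c.1.map x).prod

/-- The birational transfer map `φ(x)_p = x_p / ∑_{q ⋖ p} x_q`. -/
noncomputable def phi (r s : ℕ) (x : ℤ × ℤ → ℝ) : ℤ × ℤ → ℝ :=
  fun p => x p / dsum r s x p

/-- A collection of `k` pairwise vertex-disjoint lattice paths in the interval
`[i₁,i₂] × [j₁,j₂]`, from `(i₁,j₁),…,(i₁,j₁+k-1)` to `(i₂,j₂-k+1),…,(i₂,j₂)`. -/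
structure RSys (i₁ i₂ j₁ j₂ : ℤ) (k : ℕ) where
  path : Fin k → List (ℤ × ℤ)
  chain : ∀ t, (path t).Chain' CoverStep
  mem : ∀ t, ∀ v ∈ path t, i₁ ≤ v.1 ∧ v.1 ≤ i₂ ∧ j₁ ≤ v.2 ∧ v.2 ≤ j₂
  first : ∀ t : Fin k, (path t).head? = some (i₁, j₁ + ((t : ℕ) : ℤ))
  final : ∀ t : Fin k, (path t).getLast? = some (i₂, j₂ - k + 1 + ((t : ℕ) : ℤ))
  disjoint : ∀ t t' : Fin k, t ≠ t' → ∀ v ∈ path t, v ∉ path t'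

/-- The weight of a collection of paths: the product of labels of all its elements. -/
noncomputable def RSysWeight (x : ℤ × ℤ → ℝ) {i₁ i₂ j₁ j₂ : ℤ} {k : ℕ}
    (L : RSys i₁ i₂ j₁ j₂ k) : ℝ :=
  ∏ t : Fin k, ((L.path t).map x).prod

/-- `w_I^{(k)}(x)`: total weight of all collections of `k` nonintersecting paths in the
interval `I = [i₁,i₂] × [j₁,j₂]` (with `w_I^{(0)} = 1`). -/
noncomputable def w (i₁ i₂ j₁ j₂ : ℤ) (k : ℤ) (x : ℤ × ℤ → ℝ) : ℝ :=
  if k ≤ 0 then 1 else ∑ᶠ L : RSys i₁ i₂ j₁ j₂ k.toNat, RSysWeight x L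

/-- `w_I(x)`: the product of all labels in the interval `I = [i₁,i₂] × [j₁,j₂]`. -/
noncomputable def wProd (i₁ i₂ j₁ j₂ : ℤ) (x : ℤ × ℤ → ℝ) : ℝ :=
  ∏ p ∈ Finset.Icc i₁ i₂ ×ˢ Finset.Icc j₁ j₂, x p

/-- The directed edges of the graph `𝒢_R` on vertex set `[1,r+1] × [1,s]`:
`(i,j) → (i+1,j)` for `(i,j) ∈ R`, and `(i,j) → (i+1,j-1)` when valid. -/
def GEdge (r s : ℕ) (p q : ℤ × ℤ) : Prop :=
  1 ≤ p.1 ∧ p.1 ≤ (r : ℤ) ∧ 1 ≤ p.2 ∧ p.2 ≤ (s : ℤ) ∧ q.1 = p.1 + 1 ∧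
    (q.2 = p.2 ∨ (q.2 = p.2 - 1 ∧ 2 ≤ p.2))

/-- The weight of an edge of `𝒢_R`: `x_p⁻¹` for vertical edges, `1` for diagonal ones. -/
noncomputable def edgeWt (x : ℤ × ℤ → ℝ) (p q : ℤ × ℤ) : ℝ :=
  if q.2 = p.2 then (x p)⁻¹ else 1

/-- The weight of a directed path in `𝒢_R`, given as its list of vertices. -/
noncomputable def listWt (x : ℤ × ℤ → ℝ) (l : List (ℤ × ℤ)) : ℝ :=
  ((l.zip l.tail).map fun e => edgeWt x e.1 e.2).prod

/-- The boundary vertex `P_t` of `𝒢_R`: `P_j = (1,j)` for `1 ≤ j ≤ s`, `P_{s+i} = (i+1,s)`. -/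
def Pvert (s : ℕ) (t : ℤ) : ℤ × ℤ := if t ≤ (s : ℤ) then (1, t) else (t - s + 1, (s : ℤ))

/-- The boundary vertex `Q_t` of `𝒢_R`: `Q_i = (i,1)` for `1 ≤ i ≤ r`, `Q_{r+j} = (r+1,j)`. -/
def Qvert (r : ℕ) (t : ℤ) : ℤ × ℤ := if t ≤ (r : ℤ) then (t, 1) else ((r : ℤ) + 1, t - r)

/-- A collection of `k` pairwise vertex-disjoint directed paths in `𝒢_R` from
`{P_i, …, P_{i+k-1}}` to `{Q_j, …, Q_{j+k-1}}`. -/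
structure GSys (r s : ℕ) (i j : ℤ) (k : ℕ) where
  perm : Equiv.Perm (Fin k)
  path : Fin k → List (ℤ × ℤ)
  chain : ∀ t, (path t).Chain' (GEdge r s)
  first : ∀ t : Fin k, (path t).head? = some (Pvert s (i + ((t : ℕ) : ℤ)))
  final : ∀ t : Fin k, (path t).getLast? = some (Qvert r (j + (((perm t) : ℕ) : ℤ)))
  disjoint : ∀ t t' : Fin k, t ≠ t' → ∀ v ∈ path t, v ∉ path t'

/-- The weight of a collection of paths in `𝒢_R`: the product of the weights of all
edges used. -/
noncomputable def GSysWeight (x : ℤ × ℤ → ℝ) {r s : ℕ} {i j : ℤ} {k : ℕ}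
    (L : GSys r s i j k) : ℝ :=
  ∏ t : Fin k, listWt x (L.path t)

/-- `W_{ij}^{(k)}(x)`: total weight of all collections of `k` nonintersecting paths in
`𝒢_R` from `{P_i,…,P_{i+k-1}}` to `{Q_j,…,Q_{j+k-1}}`; `W_{ij}^{(0)} = 1`, and `0` when an
out-of-range index occurs. -/
noncomputable def W (r s : ℕ) (x : ℤ × ℤ → ℝ) (i j k : ℤ) : ℝ :=
  if k < 0 then 0
  else if k = 0 then 1
  else if 1 ≤ i ∧ 1 ≤ j ∧ i + k - 1 ≤ (r : ℤ) + s ∧ j + k - 1 ≤ (r : ℤ) + s then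
    ∑ᶠ L : GSys r s i j k.toNat, GSysWeight x L
  else 0


/-- `ρ_{[1,a]×[1,b]}⁻¹`: the inverse of the composition of the toggles of `R = [r] × [s]`
at the elements of the interval `[1,a] × [1,b]` (toggles applied from bottom to top). -/
noncomputable def rhoIInv (r s a b : ℕ) (x : ℤ × ℤ → ℝ) : ℤ × ℤ → ℝ :=
  (rectList a b).reverse.foldl (fun y p => toggle r s p y) x

/-- Auxiliary iterate: `RSKaux r s t = ρ_{[r-t]×[s-t]}⁻¹ ∘ ⋯ ∘ ρ_{[r-1]×[s-1]}⁻¹`. -/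
noncomputable def RSKaux (r s : ℕ) : ℕ → (ℤ × ℤ → ℝ) → (ℤ × ℤ → ℝ)
  | 0 => fun x => x
  | t + 1 => fun x => rhoIInv r s (r - (t + 1)) (s - (t + 1)) (RSKaux r s t x)

/-- The birational RSK map on labelings of `R = [r] × [s]`: with `m = min{r,s} - 1`,
`RSK = ρ_{[r-m]×[s-m]}⁻¹ ∘ ⋯ ∘ ρ_{[r-2]×[s-2]}⁻¹ ∘ ρ_{[r-1]×[s-1]}⁻¹ ∘ φ⁻¹`. -/
noncomputable def RSK (r s : ℕ) (x : ℤ × ℤ → ℝ) : ℤ × ℤ → ℝ :=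
  RSKaux r s (min r s - 1) (phiInv x)

theorem det_mul_det_eq_sum_exchange {n : Type*} [Fintype n] [DecidableEq n]
    (A B : Matrix n n ℝ) (p : n) :
    A.det * B.det = ∑ i, (A.updateCol i (fun t => B t p)).det *
      (B.updateCol p (fun t => A t i)).det := by
  have h := congrFun (congrArg B.cramer (A.mulVec_cramer fun t => B t p)) p
  have h1 : A.mulVec (A.cramer fun t => B t p) =
      ∑ i, (A.cramer fun t => B t p) i • (fun t => A t i) := by
    ext t
    simp [Matrix.mulVec, dotProduct, mul_comm]
  rw [h1, map_sum] at h
  simp only [map_smul, Finset.sum_apply, Pi.smul_apply, smul_eq_mul,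
    Matrix.cramer_apply] at h
  rw [h, Matrix.det_updateCol_smul, Matrix.updateCol_eq_self]

/-- The determinant of the top `k × k` block with columns `c 0, …, c (k - 1)`. -/
noncomputable def colDet (c : ℕ → ℕ → ℝ) (k : ℕ) : ℝ :=
  (Matrix.of fun t m : Fin k => c m t).det

/-- Prepending a column. -/
def consCol (u : ℕ → ℝ) (c : ℕ → ℕ → ℝ) : ℕ → ℕ → ℝ
  | 0 => u
  | m + 1 => c m

theorem det_eq_colDet_of_last {n : ℕ} (c : ℕ → ℕ → ℝ) (M : Matrix (Fin (n + 1)) (Fin (n + 1)) ℝ)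
    (h : ∀ (t) (m : Fin n), M t m.castSucc = c m t)
    (hl : ∀ t, M t (Fin.last n) = if t = Fin.last n then 1 else 0) : M.det = colDet c n := by
  rw [Matrix.det_succ_column M (Fin.last n), Finset.sum_eq_single (Fin.last n)]
  · simp only [hl, if_true, colDet]
    rw [← two_mul, pow_mul]
    simp only [even_two, Even.neg_pow, one_pow, mul_one, one_mul]
    congr 1
    ext t m
    simp [h]
  · intro b _ hb
    simp [hl, hb]
  · simp

theorem colDet_plucker (u : ℕ → ℝ) (v : ℕ → ℕ → ℝ) (n : ℕ) :
    colDet (consCol u fun m => v (m + 1)) (n + 2) * colDet v (n + 1) =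
      colDet v (n + 2) * colDet (consCol u fun m => v (m + 1)) (n + 1) +
      colDet (consCol u v) (n + 2) * colDet (fun m => v (m + 1)) (n + 1) := by
  set c := consCol u fun m => v (m + 1) with hc
  set e : Fin (n + 2) → ℝ := fun t => if t = Fin.last (n + 1) then 1 else 0 with he
  set A : Matrix (Fin (n + 2)) (Fin (n + 2)) ℝ := Matrix.of fun t m : Fin (n + 2) => c m t with hA
  set B : Matrix (Fin (n + 2)) (Fin (n + 2)) ℝ :=
    (Matrix.of fun t m : Fin (n + 2) => v m t).updateCol (Fin.last (n + 1)) e with hB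
  have hBdet : B.det = colDet v (n + 1) :=
    det_eq_colDet_of_last v B
      (fun t m => by simp [hB, (Fin.castSucc_lt_last m).ne])
      (fun t => by simp [hB, he])
  have h := det_mul_det_eq_sum_exchange A B (Fin.last (n + 1))
  have hBe : (fun t => B t (Fin.last (n + 1))) = e := by ext t; simp [hB]
  have hBu : ∀ w : Fin (n + 2) → ℝ, B.updateCol (Fin.last (n + 1)) w =
      (Matrix.of fun t m : Fin (n + 2) => v m t).updateCol (Fin.last (n + 1)) w := by
    intro w; simp [hB]
  rw [hBe, Fin.sum_univ_castSucc, Fin.sum_univ_succ] at h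
  simp only [hBu] at h
  rw [Finset.sum_eq_zero, hBdet] at h
  · have h1 : (A.updateCol (Fin.last (n + 1)) e).det = colDet c (n + 1) :=
      det_eq_colDet_of_last c _
        (fun t m => by simp [hA, (Fin.castSucc_lt_last m).ne])
        (fun t => by simp [he])
    have h2 : ((Matrix.of fun t m : Fin (n + 2) => v m t).updateCol (Fin.last (n + 1))
        fun t => A t (Fin.last (n + 1))).det = colDet v (n + 2) := by
      unfold colDet
      congr 1
      ext t m
      by_cases hm : m = Fin.last (n + 1)
      · simp [hm, hA, hc, consCol]
      · simp [hm]
    have h3 : (A.updateCol (Fin.castSucc 0) e).det =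
        (-1) ^ (n + 1) * colDet (fun m => v (m + 1)) (n + 1) := by
      rw [Matrix.det_succ_column _ 0, Finset.sum_eq_single (Fin.last (n + 1))]
      · simp only [he, Fin.castSucc_zero, Matrix.updateCol_self, if_true, Fin.val_last,
          Fin.val_zero, add_zero, mul_one, colDet]
        congr 2
        ext t m
        simp [hA, hc, consCol]
      · intro b _ hb
        simp [he, hb]
      · simp
    have h4 : ((Matrix.of fun t m : Fin (n + 2) => v m t).updateCol (Fin.last (n + 1))
        fun t => A t (Fin.castSucc 0)).det = (-1) ^ (n + 1) * colDet (consCol u v) (n + 2) := by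
      have := Matrix.det_permute' (finRotate (n + 2))
        (Matrix.of fun t m : Fin (n + 2) => consCol u v m t)
      rw [sign_finRotate] at this
      simp only [Nat.add_succ_sub_one, Units.val_pow_eq_pow_val, Units.val_neg,
        Units.val_one, Int.cast_pow, Int.cast_neg, Int.cast_one] at this
      unfold colDet
      rw [← this]
      congr 1
      ext t m
      induction m using Fin.lastCases with
      | last => simp [hA, hc, consCol]
      | cast m =>
        simp [(Fin.castSucc_lt_last m).ne, consCol]
    rw [h1, h2, h3, h4] at h
    have hs : ((-1 : ℝ) ^ (n + 1)) * (-1) ^ (n + 1) = 1 := by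
      rw [← mul_pow]; simp
    change A.det * _ = _
    rw [h]
    linear_combination (colDet (fun m => v (m + 1)) (n + 1) * colDet (consCol u v) (n + 2)) * hs
  · intro i _
    refine mul_eq_zero_of_right _ (Matrix.det_zero_of_column_eq
      (i := i.succ.castSucc) (j := Fin.last (n + 1)) (Fin.castSucc_lt_last _).ne ?_)
    intro t
    simp [hA, hc, consCol]

/-- Total weight of the lattice paths from `(1, t)` to `(i, j)`, where `(0, t)` counts as the
endpoint of the empty path. -/
noncomputable def pathWt (x : ℤ × ℤ → ℝ) (t : ℕ) : ℕ → ℕ → ℝ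
  | 0, j => if j = t then 1 else 0
  | _ + 1, 0 => 0
  | i + 1, j + 1 => x ((i + 1 : ℕ), (j + 1 : ℕ)) * (pathWt x t i (j + 1) + pathWt x t (i + 1) j)
termination_by i j => i + j

theorem pathWt_zero_left (x : ℤ × ℤ → ℝ) (t j : ℕ) :
    pathWt x t 0 j = if j = t then 1 else 0 := by
  rw [pathWt]

theorem pathWt_zero_right (x : ℤ × ℤ → ℝ) {t : ℕ} (ht : 1 ≤ t) (i : ℕ) :
    pathWt x t i 0 = 0 := by
  cases i with
  | zero => rw [pathWt, if_neg (by omega)]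
  | succ i => rw [pathWt]

theorem pathWt_succ (x : ℤ × ℤ → ℝ) (t i j : ℕ) :
    pathWt x t (i + 1) (j + 1) =
      x ((i + 1 : ℕ), (j + 1 : ℕ)) * (pathWt x t i (j + 1) + pathWt x t (i + 1) j) := by
  rw [pathWt]

theorem pathWt_of_lt (x : ℤ × ℤ → ℝ) {t : ℕ} (i : ℕ) {j : ℕ} (h : j < t) :
    pathWt x t i j = 0 := by
  induction i generalizing j with
  | zero => rw [pathWt, if_neg h.ne]
  | succ i ih =>
    induction j with
    | zero => rw [pathWt]
    | succ j ihj => rw [pathWt, ih h, ihj (by omega), add_zero, mul_zero]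

theorem pathWt_self (x : ℤ × ℤ → ℝ) (t i : ℕ) :
    pathWt x (t + 1) i (t + 1) = ∏ a ∈ Finset.range i, x ((a + 1 : ℕ), (t + 1 : ℕ)) := by
  induction i with
  | zero => simp [pathWt]
  | succ i ih =>
    rw [pathWt, ih, pathWt_of_lt x (i + 1) (Nat.lt_succ_self t), add_zero,
      Finset.prod_range_succ, mul_comm]

/-- The determinant computing the weight of `k` disjoint paths from `(1, 1), …, (1, k)` to
`(i, e), …, (i, e + k - 1)`. -/
noncomputable def minor (x : ℤ × ℤ → ℝ) (k i e : ℕ) : ℝ :=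
  colDet (fun m t => pathWt x (t + 1) i (e + m)) k

theorem minor_zero (x : ℤ × ℤ → ℝ) (i e : ℕ) : minor x 0 i e = 1 := by
  simp [minor, colDet]

theorem minor_one (x : ℤ × ℤ → ℝ) (i e : ℕ) : minor x 1 i e = pathWt x 1 i e := by
  simp [minor, colDet]

theorem minor_left_boundary (x : ℤ × ℤ → ℝ) (k i : ℕ) : minor x (k + 1) i 0 = 0 :=
  Matrix.det_eq_zero_of_column_eq_zero 0 fun t => by
    simp [pathWt_zero_right]

/-- Column operations replacing all but the first endpoint by the ones just above it. -/
theorem minor_succ_eq (x : ℤ × ℤ → ℝ) (k i e : ℕ) :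
    minor x (k + 1) (i + 1) e =
      (∏ m ∈ Finset.range k, x ((i + 1 : ℕ), (e + m + 1 : ℕ))) *
        colDet (consCol (fun t => pathWt x (t + 1) (i + 1) e)
          fun m t => pathWt x (t + 1) i (e + m + 1)) (k + 1) := by
  have h := Matrix.det_mul_row
    (Fin.cons 1 fun m : Fin k => x ((i + 1 : ℕ), (e + m + 1 : ℕ)) : Fin (k + 1) → ℝ)
    (Matrix.of fun t m : Fin (k + 1) => consCol (fun t => pathWt x (t + 1) (i + 1) e)
          (fun m t => pathWt x (t + 1) i (e + m + 1)) m t)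
  simp only [Fin.prod_univ_succ, Fin.cons_zero, Fin.cons_succ, one_mul] at h
  rw [Finset.prod_range]
  unfold colDet minor colDet
  rw [← h]
  refine Matrix.det_eq_of_forall_col_eq_smul_add_pred
    (fun m => x ((i + 1 : ℕ), (e + m + 1 : ℕ))) ?_ ?_
  · intro t
    simp [consCol]
  · intro t m
    simp only [Matrix.of_apply, Fin.cons_succ, Fin.val_succ, Fin.val_castSucc, consCol]
    rw [← add_assoc, pathWt_succ, mul_add]

theorem colDet_smul_zero (a : ℝ) (u : ℕ → ℝ) (v : ℕ → ℕ → ℝ) (k : ℕ) :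
    colDet (consCol (fun t => a * u t) v) (k + 1) = a * colDet (consCol u v) (k + 1) := by
  have h := Matrix.det_mul_row (Fin.cons a fun _ => 1 : Fin (k + 1) → ℝ)
    (Matrix.of fun t m : Fin (k + 1) => consCol u v m t)
  simp only [Fin.prod_univ_succ, Fin.cons_zero, Fin.cons_succ, Finset.prod_const_one,
    mul_one] at h
  unfold colDet
  rw [← h]
  congr 1
  ext t m
  cases m using Fin.cases <;> simp [consCol]

theorem colDet_add_zero (u w : ℕ → ℝ) (v : ℕ → ℕ → ℝ) (k : ℕ) :
    colDet (consCol (fun t => u t + w t) v) (k + 1) =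
      colDet (consCol u v) (k + 1) + colDet (consCol w v) (k + 1) := by
  have h := Matrix.det_updateCol_add (Matrix.of fun t m : Fin (k + 1) => consCol u v m t) 0
    (fun t => u t) (fun t => w t)
  unfold colDet
  convert h using 2
  · ext t m
    cases m using Fin.cases <;> simp [consCol]
  all_goals
    congr 1
    ext t m
    cases m using Fin.cases <;> simp [consCol]

theorem minor_recurrence (x : ℤ × ℤ → ℝ) (k i e : ℕ) :
    minor x (k + 1) (i + 1) (e + 1) * minor x k i (e + 1) =
      x ((i + 1 : ℕ), (e + k + 1 : ℕ)) *
        (minor x (k + 1) i (e + 1) * minor x k (i + 1) (e + 1) +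
          minor x (k + 1) (i + 1) e * minor x k i (e + 2)) := by
  cases k with
  | zero => simp [minor_zero, minor_one, pathWt_succ]
  | succ n =>
    have hP := colDet_plucker (fun t => pathWt x (t + 1) (i + 1) (e + 1))
      (fun m t => pathWt x (t + 1) i (e + 1 + m)) n
    have h1 := minor_succ_eq x (n + 1) i (e + 1)
    have h2 := minor_succ_eq x n i (e + 1)
    have h3 := minor_succ_eq x (n + 1) i e
    have h4 : minor x (n + 1) i (e + 2) =
        colDet (fun m t => pathWt x (t + 1) i (e + 1 + (m + 1))) (n + 1) := by
      unfold minor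
      congr! 4
      ring
    have h5 : colDet (consCol (fun t => pathWt x (t + 1) (i + 1) (e + 1))
          fun m t => pathWt x (t + 1) i (e + 1 + m)) (n + 2) =
        x ((i + 1 : ℕ), (e + 1 : ℕ)) * colDet (consCol (fun t => pathWt x (t + 1) (i + 1) e)
          fun m t => pathWt x (t + 1) i (e + m + 1)) (n + 2) := by
      simp only [pathWt_succ]
      rw [colDet_smul_zero, colDet_add_zero]
      have : colDet (consCol (fun t => pathWt x (t + 1) i (e + 1))
          fun m t => pathWt x (t + 1) i (e + 1 + m)) (n + 2) = 0 := by
        refine Matrix.det_zero_of_column_eq (i := 0) (j := 1) (by simp) fun t => ?_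
        simp [consCol]
      rw [this, zero_add]
      simp only [add_right_comm e 1]
    rw [h5] at hP
    rw [h1, h2, h3, h4]
    simp only [minor, add_assoc, add_comm 1] at hP ⊢
    rw [Finset.prod_range_succ, Finset.prod_range_succ']
    simp only [add_assoc, add_comm 1] at hP ⊢
    linear_combination (x ((i + 1 : ℕ), (e + (n + 2) : ℕ)) *
      (∏ m ∈ Finset.range n, x ((i + 1 : ℕ), (e + (m + 2) : ℕ)))) * hP

theorem exists_linear_relation (x : ℤ × ℤ → ℝ) (hx : ∀ p, 0 < x p) (k : ℕ) :
    ∀ i n c : ℕ, i < n → k + 2 ≤ c + n → ∃ l : ℕ → ℝ, (∃ m < n, l m ≠ 0) ∧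
      ∀ t < k, ∑ m ∈ Finset.range n, l m * pathWt x (t + 1) i (c + m) = 0 := by
  intro i
  induction i with
  | zero =>
    intro n c hn hc
    refine ⟨fun m => if m = n - 1 then 1 else 0, ⟨n - 1, by omega, by simp⟩, fun t ht => ?_⟩
    refine Finset.sum_eq_zero fun m _ => ?_
    rw [pathWt_zero_left]
    split_ifs <;> simp
    omega
  | succ i ih =>
    intro n c hn hc
    obtain ⟨n, rfl⟩ : ∃ n', n = n' + 1 := ⟨n - 1, by omega⟩
    obtain ⟨l, ⟨m₀, hm₀, hl₀⟩, hl⟩ := ih n (c + 1) (by omega) (by omega)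
    refine ⟨fun m => (if m = 0 then 0 else l (m - 1) / x ((i + 1 : ℕ), (c + m : ℕ))) -
      (if m < n then l m else 0), ?_, fun t ht => ?_⟩
    · by_contra! h
      have key : ∀ m, m < n → l m = 0 := by
        intro m
        induction m with
        | zero =>
          intro hm
          simpa [hm] using h 0 (by omega)
        | succ m ihm =>
          intro hm
          simpa [hm, ihm (by omega)] using h (m + 1) (by omega)
      exact hl₀ (key m₀ hm₀)
    · have h1 : ∑ m ∈ Finset.range (n + 1), (if m = 0 then 0 else
          l (m - 1) / x ((i + 1 : ℕ), (c + m : ℕ))) * pathWt x (t + 1) (i + 1) (c + m) =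
          ∑ m ∈ Finset.range n, l m *
            (pathWt x (t + 1) i (c + 1 + m) + pathWt x (t + 1) (i + 1) (c + m)) := by
        rw [Finset.sum_range_succ']
        simp only [Nat.add_eq_zero_iff, one_ne_zero, and_false, if_false, if_true, zero_mul,
          add_zero, add_tsub_cancel_right]
        refine Finset.sum_congr rfl fun m _ => ?_
        have := (hx ((i + 1 : ℕ), (c + m + 1 : ℕ))).ne'
        rw [← add_assoc, pathWt_succ, add_right_comm c 1 m]
        field_simp
      have h2 : ∑ m ∈ Finset.range (n + 1), (if m < n then l m else 0) *
          pathWt x (t + 1) (i + 1) (c + m) =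
          ∑ m ∈ Finset.range n, l m * pathWt x (t + 1) (i + 1) (c + m) := by
        rw [Finset.sum_range_succ]
        simp only [lt_irrefl, if_false, zero_mul, add_zero]
        refine Finset.sum_congr rfl fun m hm => ?_
        rw [if_pos (Finset.mem_range.1 hm)]
      simp only [sub_mul, Finset.sum_sub_distrib]
      rw [h1, h2, ← Finset.sum_sub_distrib, ← hl t ht]
      exact Finset.sum_congr rfl fun m _ => by ring

theorem minor_eq_zero (x : ℤ × ℤ → ℝ) (hx : ∀ p, 0 < x p) {k i : ℕ} (h : i ≤ k) (e : ℕ) :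
    minor x (k + 1) i (e + 2) = 0 := by
  obtain ⟨l, ⟨m₀, hm₀, hl₀⟩, hl⟩ :=
    exists_linear_relation x hx (k + 1) i (k + 1) (e + 2) (by omega) (by omega)
  refine Matrix.exists_mulVec_eq_zero_iff.1 ⟨fun m : Fin (k + 1) => l m, fun h0 => ?_, ?_⟩
  · exact hl₀ (congrFun h0 ⟨m₀, hm₀⟩)
  · ext t
    have := hl t t.2
    rw [Finset.sum_range] at this
    simpa [Matrix.mulVec, dotProduct, mul_comm] using this

theorem minor_leftmost (x : ℤ × ℤ → ℝ) (k i : ℕ) :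
    minor x k i 1 =
      ∏ b ∈ Finset.range k, ∏ a ∈ Finset.range i, x ((a + 1 : ℕ), (b + 1 : ℕ)) := by
  unfold minor colDet
  rw [Matrix.det_of_isUpperTriangular, Finset.prod_range]
  · refine Finset.prod_congr rfl fun t _ => ?_
    rw [← pathWt_self, Matrix.of_apply]
    simp only [add_comm 1]
  · intro t m h
    exact pathWt_of_lt x i (by have : (m : ℕ) < t := h; omega)

theorem minor_full (x : ℤ × ℤ → ℝ) (hx : ∀ p, 0 < x p) (k e : ℕ) :
    minor x k k (e + 1) =
      ∏ b ∈ Finset.range (k + e), ∏ a ∈ Finset.range k, x ((a + 1 : ℕ), (b + 1 : ℕ)) := by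
  induction k generalizing e with
  | zero => simp [minor_zero]
  | succ k ih =>
    induction e with
    | zero => exact minor_leftmost x _ _
    | succ e ihe =>
      have h := minor_recurrence x k k (e + 1)
      rw [minor_eq_zero x hx le_rfl, zero_mul, zero_add, ihe, ih, ih (e + 2)] at h
      have hpos : 0 < ∏ b ∈ Finset.range (k + (e + 1)), ∏ a ∈ Finset.range k,
          x ((a + 1 : ℕ), (b + 1 : ℕ)) :=
        Finset.prod_pos fun _ _ => Finset.prod_pos fun _ _ => hx _
      refine mul_right_cancel₀ hpos.ne' (h.trans ?_)
      rw [show k + (e + 2) = k + e + 1 + 1 by ring, show k + 1 + e = k + e + 1 by ring,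
        show k + 1 + (e + 1) = k + e + 1 + 1 by ring, show k + (e + 1) = k + e + 1 by ring,
        Finset.prod_range_succ _ (k + e + 1), Finset.prod_range_succ _ (k + e + 1),
        Finset.prod_range_succ _ k]
      rw [show e + 1 + k + 1 = k + e + 1 + 1 by ring]
      ring

theorem minor_pos (x : ℤ × ℤ → ℝ) (hx : ∀ p, 0 < x p) (k i e : ℕ) (h : k ≤ i) :
    0 < minor x k i (e + 1) := by
  induction k generalizing i e with
  | zero => simp [minor_zero]
  | succ k ih =>
    induction i generalizing e with
    | zero => omega
    | succ i ihi =>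
      induction e with
      | zero =>
        rw [zero_add, minor_leftmost]
        exact Finset.prod_pos fun _ _ => Finset.prod_pos fun _ _ => hx _
      | succ e ihe =>
        have h1 := minor_recurrence x k i (e + 1)
        have h2 : 0 ≤ minor x (k + 1) i (e + 2) := by
          rcases (show i ≤ k ∨ k + 1 ≤ i by omega) with hi | hi
          · exact (minor_eq_zero x hx hi e).ge
          · exact (ihi (e + 1) hi).le
        have h3 := ih (i + 1) (e + 1) (by omega)
        have h4 := ih i (e + 2) (by omega)
        have h5 := ih i (e + 1) (by omega)
        refine pos_of_mul_pos_left (lt_of_lt_of_eq ?_ h1.symm) h5.le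
        have := hx ((i + 1 : ℕ), (e + 1 + k + 1 : ℕ))
        have h6 := mul_pos ihe h4
        have h7 := mul_nonneg h2 h3.le
        exact mul_pos this (by linarith)

/-- The labels after `t` rowmotion steps. -/
noncomputable def rskLabel (x : ℤ × ℤ → ℝ) (t a b : ℕ) : ℝ :=
  minor x (t + 1) (a + t) b / minor x t (a + t) (b + 1)

theorem rskLabel_zero_right (x : ℤ × ℤ → ℝ) (t a : ℕ) : rskLabel x t a 0 = 0 := by
  rw [rskLabel, minor_left_boundary, zero_div]

theorem rskLabel_zero_left (x : ℤ × ℤ → ℝ) (hx : ∀ p, 0 < x p) (t b : ℕ) :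
    rskLabel x t 0 b = if b = 1 then 1 else 0 := by
  rw [rskLabel, zero_add]
  match b with
  | 0 => rw [minor_left_boundary]; simp
  | 1 =>
    rw [minor_leftmost, minor_full x hx, if_pos rfl]
    exact div_self (Finset.prod_pos fun _ _ => Finset.prod_pos fun _ _ => hx _).ne'
  | b + 2 => rw [minor_eq_zero x hx le_rfl]; simp

theorem rskLabel_recurrence (x : ℤ × ℤ → ℝ) (hx : ∀ p, 0 < x p) (t a b : ℕ) :
    rskLabel x (t + 1) (a + 1) (b + 1) =
      ((rskLabel x t (a + 2) (b + 1))⁻¹ + (rskLabel x t (a + 1) (b + 2))⁻¹)⁻¹ *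
        (rskLabel x (t + 1) a (b + 1) + rskLabel x (t + 1) (a + 1) b) /
          rskLabel x t (a + 1) (b + 1) := by
  have h1 := minor_recurrence x (t + 1) (a + 1 + t) b
  have h2 := minor_recurrence x t (a + 1 + t) (b + 1)
  rw [show b + (t + 1) + 1 = b + 1 + t + 1 by ring] at h1
  have hX := hx ((a + 1 + t + 1 : ℕ), (b + 1 + t + 1 : ℕ))
  unfold rskLabel
  rw [show a + 1 + (t + 1) = a + 1 + t + 1 by ring, show a + 2 + t = a + 1 + t + 1 by ring,
    show a + (t + 1) = a + 1 + t by ring]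
  have p1 := minor_pos x hx (t + 1) (a + 1 + t + 1) b (by omega)
  have p2 := minor_pos x hx (t + 1) (a + 1 + t + 1) (b + 1) (by omega)
  have p3 := minor_pos x hx (t + 1) (a + 1 + t) b (by omega)
  have p4 := minor_pos x hx (t + 1) (a + 1 + t) (b + 1) (by omega)
  have p5 := minor_pos x hx t (a + 1 + t) b (by omega)
  have p6 := minor_pos x hx t (a + 1 + t) (b + 1) (by omega)
  have p7 := minor_pos x hx t (a + 1 + t) (b + 2) (by omega)
  have p8 := minor_pos x hx t (a + 1 + t + 1) (b + 1) (by omega)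
  simp only [add_assoc b, Nat.reduceAdd] at *
  set u₁ := minor x (t + 1) (a + 1 + t + 1) (b + 1)
  set u₂ := minor x (t + 1) (a + 1 + t + 1) (b + 2)
  set u₃ := minor x (t + 1) (a + 1 + t) (b + 1)
  set u₄ := minor x (t + 1) (a + 1 + t) (b + 2)
  set u₆ := minor x t (a + 1 + t) (b + 2)
  set u₇ := minor x t (a + 1 + t) (b + 3)
  set u₈ := minor x t (a + 1 + t + 1) (b + 2)
  rw [inv_div, inv_div, div_add_div _ _ p1.ne' p4.ne', div_add_div _ _ p4.ne' p1.ne', inv_div,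
    div_mul_div_comm, div_div_div_eq, div_eq_div_iff (by positivity) (by positivity)]
  linear_combination (u₁ * u₄) * ((u₄ * u₈ + u₁ * u₇) * h1 -
    (minor x (t + 1 + 1) (a + 1 + t) (b + 1) * u₁ +
      minor x (t + 1 + 1) (a + 1 + t + 1) b * u₄) * h2)

/-- The lattice paths from `(1, t)` to `(i, j)`, each listed starting from its endpoint `(i, j)`;
the empty path ends at `(0, t)`. -/
def paths (t : ℕ) : ℕ → ℕ → Finset (List (ℤ × ℤ))
  | 0, j => if j = t then {[]} else ∅
  | _ + 1, 0 => ∅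
  | i + 1, j + 1 => (paths t i (j + 1) ∪ paths t (i + 1) j).image
      (List.cons ((i + 1 : ℕ), (j + 1 : ℕ)))
termination_by i j => i + j

theorem mem_paths_zero_left {t j : ℕ} {l : List (ℤ × ℤ)} :
    l ∈ paths t 0 j ↔ j = t ∧ l = [] := by
  rw [paths]
  split_ifs with h <;> simp [h]

theorem mem_paths_succ {t i j : ℕ} {l : List (ℤ × ℤ)} :
    l ∈ paths t (i + 1) (j + 1) ↔ ∃ l', (l' ∈ paths t i (j + 1) ∨ l' ∈ paths t (i + 1) j) ∧
      (((i + 1 : ℕ), (j + 1 : ℕ)) : ℤ × ℤ) :: l' = l := by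
  rw [paths, Finset.mem_image]
  simp only [Finset.mem_union]

theorem not_mem_paths_zero_right {t : ℕ} (ht : 1 ≤ t) (i : ℕ) (l : List (ℤ × ℤ)) :
    l ∉ paths t i 0 := by
  cases i with
  | zero => rw [mem_paths_zero_left]; omega
  | succ i => rw [paths]; simp

theorem head_of_mem_paths {t i j : ℕ} {l : List (ℤ × ℤ)} (h : l ∈ paths t (i + 1) j) :
    ∃ l', l = (((i + 1 : ℕ), (j : ℕ)) : ℤ × ℤ) :: l' := by
  cases j with
  | zero => rw [paths] at h; simp at h
  | succ j =>
    obtain ⟨l', -, rfl⟩ := mem_paths_succ.1 h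
    exact ⟨l', rfl⟩

theorem bounds_of_mem_paths {t i j : ℕ} {l : List (ℤ × ℤ)} (h : l ∈ paths t i j) :
    ∀ v ∈ l, 1 ≤ v.1 ∧ v.1 ≤ i ∧ 1 ≤ v.2 ∧ v.2 ≤ j := by
  induction i generalizing j l with
  | zero =>
    obtain ⟨-, rfl⟩ := mem_paths_zero_left.1 h
    simp
  | succ i ih =>
    induction j generalizing l with
    | zero => rw [paths] at h; simp at h
    | succ j ihj =>
      obtain ⟨l', hl', rfl⟩ := mem_paths_succ.1 h
      intro v hv
      rcases List.mem_cons.1 hv with rfl | hv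
      · simp only; push_cast; omega
      · rcases hl' with hl' | hl'
        · have := ih hl' v hv
          push_cast at *; omega
        · have := ihj hl' v hv
          push_cast at *; omega

theorem disjoint_paths (t i j : ℕ) : Disjoint (paths t i (j + 1)) (paths t (i + 1) j) := by
  rw [Finset.disjoint_left]
  intro l h1 h2
  obtain ⟨l', rfl⟩ := head_of_mem_paths h2
  have := bounds_of_mem_paths h1 _ List.mem_cons_self
  push_cast at this
  omega

theorem sum_paths (x : ℤ × ℤ → ℝ) (t i j : ℕ) :
    ∑ l ∈ paths t i j, (l.map x).prod = pathWt x t i j := by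
  induction i generalizing j with
  | zero =>
    rw [paths, pathWt]
    split_ifs <;> simp
  | succ i ih =>
    induction j with
    | zero => rw [paths, pathWt]; simp
    | succ j ihj =>
      rw [paths, pathWt, Finset.sum_image (by simp), Finset.sum_union (disjoint_paths t i j),
        ← ih, ← ihj, mul_add, Finset.mul_sum, Finset.mul_sum]
      simp

/-- Families of pairwise disjoint paths, the `m`-th one from `(1, m + 1)` to `(ρ m, c m)`. -/
def systems {k : ℕ} (ρ c : Fin k → ℕ) : Finset (Fin k → List (ℤ × ℤ)) :=
  (Fintype.piFinset fun m : Fin k => paths (m + 1) (ρ m) (c m)).filter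
    fun L => ∀ m m' : Fin k, m ≠ m' → ∀ v ∈ L m, v ∉ L m'

theorem mem_systems {k : ℕ} {ρ c : Fin k → ℕ} {L : Fin k → List (ℤ × ℤ)} :
    L ∈ systems ρ c ↔ (∀ m : Fin k, L m ∈ paths (m + 1) (ρ m) (c m)) ∧
      ∀ m m', m ≠ m' → ∀ v ∈ L m, v ∉ L m' := by
  simp only [systems, Finset.mem_filter, Fintype.mem_piFinset]

/-- The total weight of the families in `systems ρ c`. -/
noncomputable def systemsWt (x : ℤ × ℤ → ℝ) {k : ℕ} (ρ c : Fin k → ℕ) : ℝ :=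
  ∑ L ∈ systems ρ c, ∏ m, ((L m).map x).prod

theorem systemsWt_eq_zero (x : ℤ × ℤ → ℝ) {k : ℕ} {ρ c : Fin k → ℕ} (h : ∀ L, L ∉ systems ρ c) :
    systemsWt x ρ c = 0 := by
  rw [systemsWt, Finset.eq_empty_of_forall_notMem h, Finset.sum_empty]

theorem update_cons_mem_systems {k : ℕ} {ρ c : Fin k → ℕ} {m : Fin k} {i j : ℕ}
    (hi : ρ m = i + 1) (hj : c m = j + 1)
    (hmax : ∀ m', m' ≠ m → ρ m' < i + 1 ∨ c m' < j + 1) (L : Fin k → List (ℤ × ℤ)) :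
    Function.update L m ((((i + 1 : ℕ), (j + 1 : ℕ)) : ℤ × ℤ) :: L m) ∈ systems ρ c ↔
      L ∈ systems (Function.update ρ m i) c ∨ L ∈ systems ρ (Function.update c m j) := by
  set p : ℤ × ℤ := ((i + 1 : ℕ), (j + 1 : ℕ)) with hp
  have hmem : (∀ m' : Fin k, Function.update L m (p :: L m) m' ∈ paths (m' + 1) (ρ m') (c m')) ↔
      ((∀ m' : Fin k, L m' ∈ paths (m' + 1) (Function.update ρ m i m') (c m')) ∨
        ∀ m' : Fin k, L m' ∈ paths (m' + 1) (ρ m') (Function.update c m j m')) := by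
    have h0 : p :: L m ∈ paths (m + 1) (ρ m) (c m) ↔
        L m ∈ paths (m + 1) i (c m) ∨ L m ∈ paths (m + 1) (ρ m) j := by
      rw [hi, hj, mem_paths_succ]
      constructor
      · rintro ⟨l', h, he⟩
        obtain rfl := (List.cons.inj he).2
        exact h
      · exact fun h => ⟨_, h, rfl⟩
    constructor
    · intro h
      have h1 := h m
      rw [Function.update_self, h0] at h1
      refine h1.imp (fun h1 m' => ?_) (fun h1 m' => ?_)
      all_goals
        by_cases hm : m' = m
        · subst hm
          simpa using h1
        · simpa [hm] using h m'
    · rintro (h | h) m' <;> by_cases hm : m' = m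
      · subst hm
        rw [Function.update_self, h0]
        exact Or.inl (by simpa using h m')
      · simpa [hm] using h m'
      · subst hm
        rw [Function.update_self, h0]
        exact Or.inr (by simpa using h m')
      · simpa [hm] using h m'
  rw [mem_systems, mem_systems, mem_systems, ← or_and_right, hmem]
  refine and_congr_right fun hL => ?_
  have hpL : ∀ m', m' ≠ m → p ∉ L m' := by
    intro m' hm hpm
    have hb : L m' ∈ paths (m' + 1) (ρ m') (c m') := by
      rcases hL with h | h <;> simpa [hm] using h m'
    have := bounds_of_mem_paths hb p hpm
    have := hmax m' hm
    simp only [hp] at *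
    push_cast at *
    omega
  constructor
  · intro h a b hab v hva hvb
    refine h a b hab v ?_ ?_
    · by_cases ha : a = m
      · subst ha; simp [hva]
      · simpa [ha] using hva
    · by_cases hb : b = m
      · subst hb; simp [hvb]
      · simpa [hb] using hvb
  · intro h a b hab v hva hvb
    by_cases ha : a = m
    · subst ha
      rw [Function.update_self] at hva
      rw [Function.update_of_ne hab.symm] at hvb
      rcases List.mem_cons.1 hva with rfl | hva
      · exact hpL b hab.symm hvb
      · exact h a b hab v hva hvb
    · rw [Function.update_of_ne ha] at hva
      by_cases hb : b = m
      · subst hb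
        rw [Function.update_self] at hvb
        rcases List.mem_cons.1 hvb with rfl | hvb
        · exact hpL a hab hva
        · exact h a b hab v hva hvb
      · rw [Function.update_of_ne hb] at hvb
        exact h a b hab v hva hvb

/-- Removing a maximal endpoint from a family of disjoint paths. -/
theorem systemsWt_succ (x : ℤ × ℤ → ℝ) {k : ℕ} {ρ c : Fin k → ℕ} {m : Fin k} {i j : ℕ}
    (hi : ρ m = i + 1) (hj : c m = j + 1)
    (hmax : ∀ m', m' ≠ m → ρ m' < i + 1 ∨ c m' < j + 1) :
    systemsWt x ρ c = x ((i + 1 : ℕ), (j + 1 : ℕ)) *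
      (systemsWt x (Function.update ρ m i) c + systemsWt x ρ (Function.update c m j)) := by
  have hdisj : Disjoint (systems (Function.update ρ m i) c)
      (systems ρ (Function.update c m j)) := by
    rw [Finset.disjoint_left]
    intro L h1 h2
    have h1 := (mem_systems.1 h1).1 m
    have h2 := (mem_systems.1 h2).1 m
    rw [Function.update_self] at h1 h2
    rw [hj] at h1
    rw [hi] at h2
    exact Finset.disjoint_left.1 (disjoint_paths _ i j) h1 h2
  unfold systemsWt
  rw [← Finset.sum_union hdisj, Finset.mul_sum]
  symm
  refine Finset.sum_nbij' (fun L => Function.update L m ((((i + 1 : ℕ), (j + 1 : ℕ)) : ℤ × ℤ) :: L m))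
    (fun L => Function.update L m (L m).tail) ?_ ?_ ?_ ?_ ?_
  · intro L hL
    exact (update_cons_mem_systems hi hj hmax L).2 (Finset.mem_union.1 hL)
  · intro L hL
    have hm := (mem_systems.1 hL).1 m
    rw [hi, hj] at hm
    obtain ⟨l', hl'⟩ := head_of_mem_paths hm
    rw [Finset.mem_union, ← update_cons_mem_systems hi hj hmax]
    have he : (((i + 1 : ℕ), (j + 1 : ℕ)) : ℤ × ℤ) :: (L m).tail = L m := by
      rw [hl']; rfl
    rwa [Function.update_self, Function.update_idem, he, Function.update_eq_self]
  · intro L _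
    simp
  · intro L hL
    have hm := (mem_systems.1 hL).1 m
    rw [hi, hj] at hm
    obtain ⟨l', hl'⟩ := head_of_mem_paths hm
    have he : (((i + 1 : ℕ), (j + 1 : ℕ)) : ℤ × ℤ) :: (L m).tail = L m := by
      rw [hl']; rfl
    simp only [Function.update_self, Function.update_idem, he, Function.update_eq_self]
  · intro L _
    rw [← Finset.mul_prod_erase _ _ (Finset.mem_univ m),
      ← Finset.mul_prod_erase _ _ (Finset.mem_univ m), Function.update_self, List.map_cons,
      List.prod_cons, mul_assoc]
    congr 2
    refine Finset.prod_congr rfl fun m' hm' => ?_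
    rw [Function.update_of_ne (Finset.ne_of_mem_erase hm')]

/-- The matrix of path weights. -/
noncomputable def pathMat (x : ℤ × ℤ → ℝ) {k : ℕ} (ρ c : Fin k → ℕ) : Matrix (Fin k) (Fin k) ℝ :=
  Matrix.of fun t m => pathWt x (t + 1) (ρ m) (c m)

theorem det_pathMat_succ (x : ℤ × ℤ → ℝ) {k : ℕ} {ρ c : Fin k → ℕ} {m : Fin k} {i j : ℕ}
    (hi : ρ m = i + 1) (hj : c m = j + 1) :
    (pathMat x ρ c).det = x ((i + 1 : ℕ), (j + 1 : ℕ)) *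
      ((pathMat x (Function.update ρ m i) c).det + (pathMat x ρ (Function.update c m j)).det) := by
  have h1 : pathMat x (Function.update ρ m i) c = (pathMat x ρ c).updateCol m
      (fun t => pathWt x (t + 1) i (j + 1)) := by
    ext t m'
    by_cases hm : m' = m
    · subst hm; simp [pathMat, hj]
    · simp [pathMat, hm]
  have h2 : pathMat x ρ (Function.update c m j) = (pathMat x ρ c).updateCol m
      (fun t => pathWt x (t + 1) (i + 1) j) := by
    ext t m'
    by_cases hm : m' = m
    · subst hm; simp [pathMat, hi]
    · simp [pathMat, hm]
  rw [h1, h2, ← Matrix.det_updateCol_add, ← Matrix.det_updateCol_smul]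
  congr 1
  ext t m'
  by_cases hm : m' = m
  · subst hm; simp [pathMat, hi, hj, pathWt_succ]; ring
  · simp [hm]

theorem systemsWt_eq_det_of_col_zero (x : ℤ × ℤ → ℝ) {k : ℕ} (ρ c : Fin k → ℕ) {m : Fin k}
    (hm : c m = 0) : systemsWt x ρ c = (pathMat x ρ c).det := by
  rw [systemsWt_eq_zero, Matrix.det_eq_zero_of_column_eq_zero m]
  · intro t
    simp [pathMat, hm, pathWt_zero_right]
  · intro L hL
    have := (mem_systems.1 hL).1 m
    rw [hm] at this
    exact not_mem_paths_zero_right (by omega) _ _ this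

theorem systemsWt_eq_det_of_row_zero (x : ℤ × ℤ → ℝ) {k : ℕ} {ρ c : Fin k → ℕ}
    (hc : StrictMono c) (hc0 : ∀ m, c m ≠ 0) (hρ : ∀ m, ρ m = 0) :
    systemsWt x ρ c = (pathMat x ρ c).det := by
  have hle : ∀ n (hn : n < k), n + 1 ≤ c ⟨n, hn⟩ := by
    intro n
    induction n with
    | zero => exact fun hn => Nat.one_le_iff_ne_zero.2 (hc0 _)
    | succ n ih =>
      intro hn
      exact (Nat.succ_le_succ (ih (by omega))).trans
        (hc (show (⟨n, by omega⟩ : Fin k) < ⟨n + 1, hn⟩ by simp))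
  rw [Matrix.det_of_isLowerTriangular]
  · by_cases h : ∀ m : Fin k, c m = m + 1
    · have hs : systems ρ c = {fun _ => []} := by
        ext L
        simp only [mem_systems, hρ, h, mem_paths_zero_left, Finset.mem_singleton, true_and]
        constructor
        · exact fun hL => funext hL.1
        · rintro rfl
          simp
      rw [systemsWt, hs]
      simp [pathMat, hρ, h, pathWt_zero_left]
    · push Not at h
      obtain ⟨m, hm⟩ := h
      rw [systemsWt_eq_zero, Finset.prod_eq_zero (Finset.mem_univ m)]
      · simp [pathMat, hρ, hm, pathWt_zero_left]
      · intro L hL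
        have := (mem_systems.1 hL).1 m
        rw [hρ, mem_paths_zero_left] at this
        exact hm this.1
  · intro t m (h : t < m)
    have := hle m m.2
    simp only [Fin.eta] at this
    simp only [pathMat, Matrix.of_apply, hρ, pathWt_zero_left]
    rw [if_neg]
    have : (t : ℕ) < m := h
    omega

/-- The Lindström–Gessel–Viennot formula for rectangular grids. -/
theorem systemsWt_eq_det (x : ℤ × ℤ → ℝ) {k : ℕ} (ρ c : Fin k → ℕ) (hρ : Antitone ρ)
    (hc : StrictMono c) : systemsWt x ρ c = (pathMat x ρ c).det := by
  induction hN : ∑ m, (ρ m + c m) using Nat.strong_induction_on generalizing ρ c with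
  | _ N ih =>
  by_cases h0 : ∃ m, c m = 0
  · obtain ⟨m, hm⟩ := h0
    exact systemsWt_eq_det_of_col_zero x ρ c hm
  push Not at h0
  by_cases hr : ∀ m, ρ m = 0
  · exact systemsWt_eq_det_of_row_zero x hc h0 hr
  push Not at hr
  obtain ⟨m₀, hm₀⟩ := hr
  obtain ⟨m, hle, hm⟩ : ∃ m, (∀ m', ρ m' ≤ ρ m) ∧ ∀ m', m < m' → ρ m' < ρ m := by
    have hk : 0 < k := m₀.pos
    obtain ⟨m, hm1, hm2⟩ := (Finset.univ.filter fun m => ρ m = ρ ⟨0, hk⟩).exists_max_image id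
      ⟨⟨0, hk⟩, by simp⟩
    simp only [Finset.mem_filter, Finset.mem_univ, true_and, id] at hm1 hm2
    have hle : ∀ m', ρ m' ≤ ρ m := fun m' => hm1 ▸ hρ (Fin.mk_le_mk.2 (Nat.zero_le _))
    exact ⟨m, hle, fun m' h => lt_of_le_of_ne (hle m') fun he =>
      absurd (hm2 m' (he.trans hm1)) (not_le.2 h)⟩
  obtain ⟨i, hi⟩ : ∃ i, ρ m = i + 1 := ⟨ρ m - 1, by have := hle m₀; omega⟩
  obtain ⟨j, hj⟩ : ∃ j, c m = j + 1 := ⟨c m - 1, by have := h0 m; omega⟩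
  have hlow : ∀ m', m' < m → ρ m' = i + 1 := fun m' h =>
    le_antisymm (hi ▸ hle m') (hi ▸ hρ h.le)
  rw [systemsWt_succ x hi hj, det_pathMat_succ x hi hj]
  · congr 2
    · refine ih _ ?_ _ _ ?_ hc rfl
      · rw [← hN]
        refine Finset.sum_lt_sum (fun m' _ => ?_) ⟨m, Finset.mem_univ _, by simp [hi]⟩
        by_cases h : m' = m
        · subst h; simp [hi]
        · simp [h]
      · intro a b hab
        rcases hab.eq_or_lt with rfl | hab
        · rfl
        · by_cases ha : a = m
          · subst ha
            have := hm b hab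
            simp [hab.ne']
            omega
          · by_cases hb : b = m
            · subst hb
              have := hlow a hab
              simp [ha]
              omega
            · simpa [ha, hb] using hρ hab.le
    · by_cases hcol : ∃ m' < m, c m' = j
      · obtain ⟨m', hm', hc'⟩ := hcol
        rw [systemsWt_eq_zero, Matrix.det_zero_of_column_eq (i := m') (j := m) hm'.ne]
        · intro t
          simp [pathMat, hm'.ne, hc', hlow m' hm', hi]
        · intro L hL
          obtain ⟨hL1, hL2⟩ := mem_systems.1 hL
          have h1 := hL1 m'
          have h2 := hL1 m
          rw [Function.update_of_ne hm'.ne, hlow m' hm', hc'] at h1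
          rw [Function.update_self, hi] at h2
          obtain ⟨l1, hl1⟩ := head_of_mem_paths h1
          obtain ⟨l2, hl2⟩ := head_of_mem_paths h2
          exact hL2 m' m hm'.ne _ (hl1 ▸ List.mem_cons_self) (hl2 ▸ List.mem_cons_self)
      · push Not at hcol
        refine ih _ ?_ _ _ hρ ?_ rfl
        · rw [← hN]
          refine Finset.sum_lt_sum (fun m' _ => ?_) ⟨m, Finset.mem_univ _, by simp [hj]⟩
          by_cases h : m' = m
          · subst h; simp [hj]
          · simp [h]
        · intro a b hab
          have hab' := hc hab
          by_cases ha : a = m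
          · subst ha
            simp [hab.ne']
            omega
          · by_cases hb : b = m
            · subst hb
              have := hcol a hab
              simp [ha]
              omega
            · simpa [ha, hb] using hab'
  · intro m' hne
    rcases lt_or_gt_of_ne hne with h | h
    · exact Or.inr (hj ▸ hc h)
    · exact Or.inl (hi ▸ hm m' h)

theorem isChain_of_mem_paths {t i j : ℕ} (ht : 1 ≤ t) {l : List (ℤ × ℤ)}
    (h : l ∈ paths t (i + 1) j) :
    l.IsChain (fun a b => CoverStep b a) ∧ l.head? = some (((i + 1 : ℕ) : ℤ), (j : ℤ)) ∧
      l.getLast? = some (1, (t : ℤ)) := by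
  induction i generalizing j l with
  | zero =>
    induction j generalizing l with
    | zero => exact absurd h (not_mem_paths_zero_right ht _ _)
    | succ j ihj =>
      obtain ⟨l', hl', rfl⟩ := mem_paths_succ.1 h
      rcases hl' with hl' | hl'
      · obtain ⟨rfl, rfl⟩ := mem_paths_zero_left.1 hl'
        simp
      · obtain ⟨h1, h2, h3⟩ := ihj hl'
        obtain ⟨l'', rfl⟩ := head_of_mem_paths hl'
        refine ⟨List.isChain_cons_cons.2 ⟨Or.inr ⟨rfl, by simp⟩, h1⟩, rfl, ?_⟩
        rw [List.getLast?_cons_cons, h3]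
  | succ i ih =>
    induction j generalizing l with
    | zero => exact absurd h (not_mem_paths_zero_right ht _ _)
    | succ j ihj =>
      obtain ⟨l', hl', rfl⟩ := mem_paths_succ.1 h
      rcases hl' with hl' | hl'
      · obtain ⟨h1, h2, h3⟩ := ih hl'
        obtain ⟨l'', rfl⟩ := head_of_mem_paths hl'
        refine ⟨List.isChain_cons_cons.2 ⟨Or.inl ⟨by simp, rfl⟩, h1⟩, rfl, ?_⟩
        rw [List.getLast?_cons_cons, h3]
      · obtain ⟨h1, h2, h3⟩ := ihj hl'
        obtain ⟨l'', rfl⟩ := head_of_mem_paths hl'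
        refine ⟨List.isChain_cons_cons.2 ⟨Or.inr ⟨rfl, by simp⟩, h1⟩, rfl, ?_⟩
        rw [List.getLast?_cons_cons, h3]

theorem mem_paths_of_isChain {t : ℕ} (ht : 1 ≤ t) (l : List (ℤ × ℤ))
    (h : l.IsChain (fun a b => CoverStep b a)) (hlast : l.getLast? = some (1, (t : ℤ))) :
    ∃ i j : ℕ, l.head? = some (((i + 1 : ℕ) : ℤ), ((j + 1 : ℕ) : ℤ)) ∧
      l ∈ paths t (i + 1) (j + 1) := by
  induction l with
  | nil => simp at hlast
  | cons p l ih =>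
    cases l with
    | nil =>
      obtain rfl : p = (1, (t : ℤ)) := by simpa using hlast
      obtain ⟨t, rfl⟩ : ∃ u, t = u + 1 := ⟨t - 1, by omega⟩
      exact ⟨0, t, rfl, mem_paths_succ.2 ⟨[], Or.inl (mem_paths_zero_left.2 ⟨rfl, rfl⟩), rfl⟩⟩
    | cons q l =>
      rw [List.isChain_cons_cons] at h
      rw [List.getLast?_cons_cons] at hlast
      obtain ⟨i, j, hq, hmem⟩ := ih h.2 hlast
      obtain rfl : q = (((i + 1 : ℕ) : ℤ), ((j + 1 : ℕ) : ℤ)) := by simpa using hq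
      obtain ⟨p1, p2⟩ := p
      rcases h.1 with ⟨h1, h2⟩ | ⟨h1, h2⟩
      · obtain rfl : p1 = ((i + 1 + 1 : ℕ) : ℤ) := by simpa using h1
        obtain rfl : p2 = ((j + 1 : ℕ) : ℤ) := h2
        exact ⟨i + 1, j, rfl, mem_paths_succ.2 ⟨_, Or.inl hmem, rfl⟩⟩
      · obtain rfl : p2 = ((j + 1 + 1 : ℕ) : ℤ) := by simpa using h2
        obtain rfl : p1 = ((i + 1 : ℕ) : ℤ) := h1
        exact ⟨i, j + 1, rfl, mem_paths_succ.2 ⟨_, Or.inr hmem, rfl⟩⟩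

theorem reverse_mem_paths {t i j : ℕ} (ht : 1 ≤ t) (hi : 1 ≤ i) {l : List (ℤ × ℤ)} :
    l.reverse ∈ paths t i j ↔ l.IsChain CoverStep ∧ l.head? = some (1, (t : ℤ)) ∧
      l.getLast? = some ((i : ℤ), (j : ℤ)) := by
  obtain ⟨i, rfl⟩ : ∃ u, i = u + 1 := ⟨i - 1, by omega⟩
  rw [← List.getLast?_reverse (l := l), ← List.head?_reverse (l := l)]
  rw [← List.isChain_reverse (l := l)]
  constructor
  · intro h
    obtain ⟨h1, h2, h3⟩ := isChain_of_mem_paths ht h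
    exact ⟨h1, h3, h2⟩
  · rintro ⟨h1, h2, h3⟩
    obtain ⟨i', j', h4, h5⟩ := mem_paths_of_isChain ht _ h1 h2
    rw [h3] at h4
    have h4 := Prod.mk.inj (Option.some.inj h4)
    have hi := Int.natCast_inj.1 h4.1
    have hj := Int.natCast_inj.1 h4.2
    rwa [hi, hj]

theorem phiInv_eq_pathWt (x : ℤ × ℤ → ℝ) {i : ℕ} (hi : 1 ≤ i) (j : ℕ) :
    phiInv x ((i : ℤ), (j : ℤ)) = pathWt x 1 i j := by
  rw [← sum_paths, phiInv, ← Finset.sum_coe_sort, ← finsum_eq_sum_of_fintype]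
  refine finsum_eq_of_bijective
    (fun c => (⟨c.1.reverse, (reverse_mem_paths le_rfl hi).2 c.2⟩ : paths 1 i j)) ⟨?_, ?_⟩ ?_
  · intro c c' h
    exact Subtype.ext (List.reverse_injective (congrArg Subtype.val h))
  · rintro ⟨l, hl⟩
    rw [← List.reverse_reverse l] at hl
    exact ⟨⟨l.reverse, (reverse_mem_paths le_rfl hi).1 hl⟩, by simp⟩
  · intro c
    simp [List.prod_reverse]

theorem pathWt_congr {x y : ℤ × ℤ → ℝ} {t i j : ℕ}
    (h : ∀ p : ℤ × ℤ, 1 ≤ p.1 → p.1 ≤ i → 1 ≤ p.2 → p.2 ≤ j → x p = y p) :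
    pathWt x t i j = pathWt y t i j := by
  rw [← sum_paths, ← sum_paths]
  refine Finset.sum_congr rfl fun l hl => congrArg List.prod (List.map_congr_left fun v hv => ?_)
  obtain ⟨h1, h2, h3, h4⟩ := bounds_of_mem_paths hl v hv
  exact h v h1 h2 h3 h4

theorem w_eq_systemsWt (x : ℤ × ℤ → ℝ) {i j k : ℕ} (hi : 1 ≤ i) (hk : 1 ≤ k) (hkj : k ≤ j) :
    w 1 i 1 j (k : ℤ) x =
      systemsWt x (fun _ : Fin k => i) (fun m : Fin k => j - k + 1 + m) := by
  rw [w, if_neg (by omega), systemsWt, ← Finset.sum_coe_sort, ← finsum_eq_sum_of_fintype]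
  have hcast : ∀ m : Fin k, (j : ℤ) - (k : ℕ) + 1 + ((m : ℕ) : ℤ) = ((j - k + 1 + m : ℕ) : ℤ) := by
    intro m; push_cast [Nat.cast_sub hkj]; ring
  have hcast' : ∀ m : Fin k, (1 : ℤ) + ((m : ℕ) : ℤ) = ((m + 1 : ℕ) : ℤ) := by
    intro m; push_cast; ring
  have hkk : (k : ℤ).toNat = k := Int.toNat_natCast k
  rw [hkk]
  refine finsum_eq_of_bijective
    (fun L : RSys 1 i 1 j k => (⟨fun m => (L.path m).reverse, mem_systems.2 ⟨fun m =>
      (reverse_mem_paths (by omega) hi).2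
        ⟨L.chain m, hcast' m ▸ L.first m, hcast m ▸ L.final m⟩, fun m m' h v hv hv' =>
      L.disjoint m m' h v (List.mem_reverse.1 hv) (List.mem_reverse.1 hv')⟩⟩ :
        systems (fun _ : Fin k => i) (fun m : Fin k => j - k + 1 + m))) ⟨?_, ?_⟩ ?_
  · rintro ⟨p, _, _, _, _, _⟩ ⟨p', _, _, _, _, _⟩ h
    have h := congrArg Subtype.val h
    have : p = p' := funext fun m => List.reverse_injective (congrFun h m)
    subst this
    rfl
  · rintro ⟨L, hL⟩
    obtain ⟨h1, h2⟩ := mem_systems.1 hL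
    have h3 : ∀ m : Fin k, _ := fun m =>
      (reverse_mem_paths (l := (L m).reverse) (Nat.le_add_left 1 m) hi).1
        ((List.reverse_reverse (L m)).symm ▸ h1 m)
    refine ⟨⟨fun m => (L m).reverse, fun m => (h3 m).1, fun m v hv => ?_,
      fun m => hcast' m ▸ (h3 m).2.1, fun m => hcast m ▸ (h3 m).2.2, fun m m' h v hv hv' =>
      h2 m m' h v (List.mem_reverse.1 hv) (List.mem_reverse.1 hv')⟩, by simp⟩
    have := bounds_of_mem_paths (h1 m) v (List.mem_reverse.1 hv)
    have := m.2
    omega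
  · intro L
    simp [RSysWeight, List.prod_reverse]

theorem w_eq_minor (x : ℤ × ℤ → ℝ) {i j k : ℕ} (hi : 1 ≤ i) (hk : 1 ≤ k) (hkj : k ≤ j) :
    w 1 i 1 j (k : ℤ) x = minor x k i (j - k + 1) := by
  rw [w_eq_systemsWt x hi hk hkj, systemsWt_eq_det]
  · rfl
  · exact fun _ _ _ => le_rfl
  · intro m m' h
    simpa using h

theorem w_congr {x y : ℤ × ℤ → ℝ} {i j : ℤ} {k : ℤ}
    (h : ∀ p : ℤ × ℤ, 1 ≤ p.1 → p.1 ≤ i → 1 ≤ p.2 → p.2 ≤ j → x p = y p) :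
    w 1 i 1 j k x = w 1 i 1 j k y := by
  unfold w RSysWeight
  split_ifs
  · rfl
  refine finsum_congr fun L => Finset.prod_congr rfl fun m _ =>
    congrArg List.prod (List.map_congr_left fun v hv => ?_)
  obtain ⟨h1, h2, h3, h4⟩ := L.mem m v hv
  exact h v h1 h2 h3 h4

theorem foldl_toggle_eq (r s : ℕ) (y g : ℤ × ℤ → ℝ) (l : List (ℤ × ℤ))
    (h : ∀ pre p post, l = pre ++ p :: post →
      toggle r s p (fun q => if q ∈ pre then g q else y q) p = g p) :
    l.foldl (fun y p => toggle r s p y) y = fun q => if q ∈ l then g q else y q := by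
  induction l using List.reverseRecOn with
  | nil => simp
  | append_singleton l p ih =>
    rw [List.foldl_append, ih fun pre p' post he => h pre p' (post ++ [p]) (by simp [he])]
    funext q
    by_cases hq : q = p
    · subst hq
      simpa using h l q [] rfl
    · simp [toggle, hq]

theorem rectList_eq (a b : ℕ) :
    rectList a b = (List.range a).reverse.flatMap fun i : ℕ =>
      (List.range b).reverse.map fun j : ℕ => (((i + 1 : ℕ) : ℤ), ((j + 1 : ℕ) : ℤ)) := by
  simp [rectList, ← List.map_eq_flatMap, Function.comp_def]
  rw [← List.map_reverse, List.flatMap_map]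

theorem mem_rectList_reverse {a b : ℕ} {p : ℤ × ℤ} :
    p ∈ (rectList a b).reverse ↔
      ∃ i j : ℕ, i < a ∧ j < b ∧ p = (((i + 1 : ℕ) : ℤ), ((j + 1 : ℕ) : ℤ)) := by
  simp only [rectList_eq, List.mem_reverse, List.mem_flatMap, List.mem_map, List.mem_range]
  constructor
  · rintro ⟨i, hi, j, hj, rfl⟩
    exact ⟨i, j, hi, hj, rfl⟩
  · rintro ⟨i, j, hi, hj, rfl⟩
    exact ⟨i, hi, j, hj, rfl⟩

theorem pairwise_rectList_reverse (a b : ℕ) :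
    (rectList a b).reverse.Pairwise fun p q => p.1 < q.1 ∨ p.1 = q.1 ∧ p.2 < q.2 := by
  rw [List.pairwise_reverse, rectList_eq, List.pairwise_flatMap]
  refine ⟨fun i _ => ?_, ?_⟩
  · rw [List.pairwise_map, List.pairwise_reverse]
    refine List.pairwise_lt_range.imp fun h => ?_
    simpa using h
  · rw [List.pairwise_reverse]
    refine List.pairwise_lt_range.imp fun h => ?_
    simp only [List.mem_map]
    rintro _ ⟨j, -, rfl⟩ _ ⟨j', -, rfl⟩
    simpa using Or.inl h

/-- A labeling `g` on `[1,a] × [1,b]` which satisfies the local toggle relations describes the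
result of toggling the whole rectangle from bottom to top. -/
theorem rhoIInv_eq (r s a b : ℕ) (y g : ℤ × ℤ → ℝ)
    (h : ∀ i j : ℕ, i < a → j < b → ∀ z : ℤ × ℤ → ℝ,
      z ((i + 1 : ℕ), (j + 1 : ℕ)) = y ((i + 1 : ℕ), (j + 1 : ℕ)) →
      z ((i + 2 : ℕ), (j + 1 : ℕ)) = y ((i + 2 : ℕ), (j + 1 : ℕ)) →
      z ((i + 1 : ℕ), (j + 2 : ℕ)) = y ((i + 1 : ℕ), (j + 2 : ℕ)) →
      (i ≠ 0 → z ((i : ℕ), (j + 1 : ℕ)) = g ((i : ℕ), (j + 1 : ℕ))) →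
      (j ≠ 0 → z ((i + 1 : ℕ), (j : ℕ)) = g ((i + 1 : ℕ), (j : ℕ))) →
      toggle r s ((i + 1 : ℕ), (j + 1 : ℕ)) z ((i + 1 : ℕ), (j + 1 : ℕ)) =
        g ((i + 1 : ℕ), (j + 1 : ℕ))) :
    rhoIInv r s a b y = fun q => if q ∈ (rectList a b).reverse then g q else y q := by
  refine foldl_toggle_eq r s y g _ fun pre p post he => ?_
  have hpw := pairwise_rectList_reverse a b
  have hmem := fun q => mem_rectList_reverse (a := a) (b := b) (p := q)
  rw [he] at hpw hmem
  rw [List.pairwise_append, List.pairwise_cons] at hpw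
  obtain ⟨-, ⟨h1, -⟩, h2⟩ := hpw
  obtain ⟨i, j, hi, hj, rfl⟩ := (hmem p).1 (by simp)
  have hpre : ∀ q ∈ pre, q.1 < (i + 1 : ℕ) ∨ q.1 = (i + 1 : ℕ) ∧ q.2 < (j + 1 : ℕ) :=
    fun q hq => h2 q hq _ List.mem_cons_self
  have hin : ∀ i' j' : ℕ, i' < a → j' < b → (i' < i ∨ i' = i ∧ j' < j) →
      ((((i' + 1 : ℕ) : ℤ), ((j' + 1 : ℕ) : ℤ)) : ℤ × ℤ) ∈ pre := by
    intro i' j' hi' hj' hlt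
    have hm := (hmem (((i' + 1 : ℕ) : ℤ), ((j' + 1 : ℕ) : ℤ))).2 ⟨i', j', hi', hj', rfl⟩
    rcases List.mem_append.1 hm with hm | hm
    · exact hm
    rcases List.mem_cons.1 hm with hm | hm
    · have := Prod.mk.inj hm
      omega
    · have := h1 _ hm
      push_cast at this
      omega
  have hout : ∀ i' j' : ℕ, ¬ (i' < i + 1 ∨ i' = i + 1 ∧ j' < j + 1) →
      (((i' : ℤ), (j' : ℤ)) : ℤ × ℤ) ∉ pre := by
    intro i' j' hlt hm
    have := hpre _ hm
    push_cast at this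
    omega
  refine h i j hi hj _ (if_neg ?_) (if_neg ?_) (if_neg ?_) (fun h0 => if_pos ?_)
    fun h0 => if_pos ?_
  · exact hout _ _ (by omega)
  · exact hout _ _ (by omega)
  · exact hout _ _ (by omega)
  · obtain ⟨i, rfl⟩ : ∃ u, i = u + 1 := ⟨i - 1, by omega⟩
    exact hin i j (by omega) hj (by omega)
  · obtain ⟨j, rfl⟩ : ∃ u, j = u + 1 := ⟨j - 1, by omega⟩
    exact hin i j hi (by omega) (by omega)

theorem usum_eq {r s i j : ℕ} (hi : i + 2 ≤ r) (hj : j + 2 ≤ s) (z : ℤ × ℤ → ℝ) :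
    usum r s z ((i + 1 : ℕ), (j + 1 : ℕ)) =
      ((z ((i + 2 : ℕ), (j + 1 : ℕ)))⁻¹ + (z ((i + 1 : ℕ), (j + 2 : ℕ)))⁻¹)⁻¹ := by
  have hu : upSet r s ((i + 1 : ℕ), (j + 1 : ℕ)) =
      {(((i + 2 : ℕ) : ℤ), ((j + 1 : ℕ) : ℤ)), (((i + 1 : ℕ) : ℤ), ((j + 2 : ℕ) : ℤ))} := by
    rw [upSet, Finset.filter_true_of_mem]
    · push_cast; ring_nf
    · intro q hq
      rw [Finset.mem_insert, Finset.mem_singleton] at hq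
      rcases hq with rfl | rfl <;> (simp only [inR]; omega)
  rw [usum, hu, if_pos (by simp), Finset.sum_pair (by simp)]

theorem dsum_eq {r s i j : ℕ} (hi : i + 1 ≤ r) (hj : j + 1 ≤ s) (z : ℤ × ℤ → ℝ) :
    dsum r s z ((i + 1 : ℕ), (j + 1 : ℕ)) =
      if i = 0 ∧ j = 0 then 1 else
        (if i = 0 then 0 else z ((i : ℕ), (j + 1 : ℕ))) +
          if j = 0 then 0 else z ((i + 1 : ℕ), (j : ℕ)) := by
  have hd : downSet r s ((i + 1 : ℕ), (j + 1 : ℕ)) =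
      ({((i : ℤ), ((j + 1 : ℕ) : ℤ)), (((i + 1 : ℕ) : ℤ), (j : ℤ))} : Finset (ℤ × ℤ)).filter
        (inR r s) := by
    rw [downSet]
    push_cast; ring_nf
  have h1 : inR r s ((i : ℤ), ((j + 1 : ℕ) : ℤ)) ↔ i ≠ 0 := by
    simp only [inR]; omega
  have h2 : inR r s (((i + 1 : ℕ) : ℤ), (j : ℤ)) ↔ j ≠ 0 := by
    simp only [inR]; omega
  rw [dsum, hd]
  by_cases hi0 : i = 0 <;> by_cases hj0 : j = 0
  · rw [Finset.filter_false_of_mem]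
    · simp [hi0, hj0]
    · intro q hq
      rw [Finset.mem_insert, Finset.mem_singleton] at hq
      rcases hq with rfl | rfl
      · exact fun h => h1.1 h hi0
      · exact fun h => h2.1 h hj0
  all_goals
    rw [Finset.filter_insert, Finset.filter_singleton]
    simp only [h1, h2, ne_eq]
    simp [hi0, hj0]

/-- The partial iterates of birational RSK in terms of the path minors. -/
theorem RSKaux_eq (x : ℤ × ℤ → ℝ) (hx : ∀ p, 0 < x p) (r s : ℕ) (y : ℤ × ℤ → ℝ)
    (hy : ∀ i j : ℕ, i + 1 ≤ r → j + 1 ≤ s →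
      y ((i + 1 : ℕ), (j + 1 : ℕ)) = pathWt x 1 (i + 1) (j + 1)) (t : ℕ) :
    ∀ i j : ℕ, i + 1 ≤ r → j + 1 ≤ s →
      RSKaux r s t y ((i + 1 : ℕ), (j + 1 : ℕ)) =
        rskLabel x (min t (min (r - (i + 1)) (s - (j + 1)))) (i + 1) (j + 1) := by
  induction t with
  | zero =>
    intro i j hi hj
    simp only [RSKaux]
    rw [hy i j hi hj, Nat.zero_min, rskLabel, minor_one, minor_zero, div_one, add_zero]
  | succ t ih =>
    intro i j hi hj
    simp only [RSKaux]
    rw [rhoIInv_eq r s _ _ _ (fun p => rskLabel x (t + 1) p.1.toNat p.2.toNat)]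
    · dsimp only
      split_ifs with h
      · obtain ⟨i', j', hi', hj', he⟩ := mem_rectList_reverse.1 h
        have := Prod.mk.inj he
        rw [Int.toNat_natCast, Int.toNat_natCast]
        congr 1
        omega
      · rw [ih i j hi hj]
        congr 1
        have : ¬ (i < r - (t + 1) ∧ j < s - (t + 1)) := fun hij =>
          h (mem_rectList_reverse.2 ⟨i, j, hij.1, hij.2, rfl⟩)
        omega
    · intro i j hi hj z h0 h1 h2 h3 h4
      rw [ih i j (by omega) (by omega)] at h0
      rw [ih (i + 1) j (by omega) (by omega)] at h1
      rw [ih i (j + 1) (by omega) (by omega)] at h2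
      rw [Nat.min_eq_left (by omega)] at h0 h1 h2
      simp only [Int.toNat_natCast] at h3 h4 ⊢
      rw [rskLabel_recurrence x hx, toggle, if_pos rfl, usum_eq (by omega) (by omega),
        dsum_eq (by omega) (by omega), h0, h1, h2]
      congr 2
      by_cases hi0 : i = 0 <;> by_cases hj0 : j = 0
      · simp [hi0, hj0, rskLabel_zero_left x hx, rskLabel_zero_right]
      · simpa [hi0, hj0, rskLabel_zero_left x hx] using h4 hj0
      · simpa [hi0, hj0, rskLabel_zero_right] using h3 hi0
      · rw [if_neg (by tauto), if_neg hi0, if_neg hj0, h3 hi0, h4 hj0]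

theorem prod_rskLabel (x : ℤ × ℤ → ℝ) (hx : ∀ p, 0 < x p) {i j k : ℕ} (hi : k ≤ i) (hj : k ≤ j) :
    ∏ t ∈ Finset.range k, rskLabel x t (i - t) (j - t) = minor x k i (j - k + 1) := by
  induction k with
  | zero => simp [minor_zero]
  | succ k ih =>
    rw [Finset.prod_range_succ, ih (by omega) (by omega), rskLabel, Nat.sub_add_cancel (by omega),
      mul_div_cancel₀ _ (minor_pos x hx _ _ _ (by omega)).ne']
    congr 1
    omega

/-- **Birational Greene's Theorem (Theorem 5.3).** For `(i,j) ∈ R = [r] × [s]` with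
`i = r` or `j = s`, any positive labeling `x`, and `1 ≤ k ≤ min{i,j}`,
`∏_{t=0}^{k-1} RSK(x)_{i-t, j-t} = w_{[1,i] × [1,j]}^{(k)}(x)`. -/
theorem birational_greene (r s : ℕ) (hr : 1 ≤ r) (hs : 1 ≤ s) (x : ℤ × ℤ → ℝ)
    (hx : ∀ p, inR r s p → 0 < x p) (i j : ℤ) (hij : inR r s (i, j))
    (hb : i = (r : ℤ) ∨ j = (s : ℤ)) (k : ℕ) (hk1 : 1 ≤ k) (hk : (k : ℤ) ≤ min i j) :
    (∏ t ∈ Finset.range k, RSK r s x (i - t, j - t)) = w 1 i 1 j (k : ℤ) x := by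
  obtain ⟨hi1, hir, hj1, hjs⟩ := hij
  simp only at hi1 hir hj1 hjs
  lift i to ℕ using by omega
  lift j to ℕ using by omega
  rw [le_min_iff] at hk
  set x' : ℤ × ℤ → ℝ := fun p => if inR r s p then x p else 1 with hx'
  have hpos : ∀ p, 0 < x' p := by
    intro p
    simp only [hx']
    split_ifs with h
    exacts [hx p h, one_pos]
  have hagree : ∀ a b : ℕ, a ≤ r → b ≤ s →
      ∀ p : ℤ × ℤ, 1 ≤ p.1 → p.1 ≤ a → 1 ≤ p.2 → p.2 ≤ b → x p = x' p := by
    intro a b ha hb p h1 h2 h3 h4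
    exact (if_pos (show inR r s p from ⟨h1, by omega, h3, by omega⟩)).symm
  rw [w_congr (hagree i j (by omega) (by omega)), w_eq_minor x' (by omega) hk1 (by omega),
    ← prod_rskLabel x' hpos (by omega) (by omega)]
  refine Finset.prod_congr rfl fun t ht => ?_
  rw [Finset.mem_range] at ht
  obtain ⟨a, ha⟩ : ∃ a, i - t = a + 1 := ⟨i - t - 1, by omega⟩
  obtain ⟨b, hb'⟩ : ∃ b, j - t = b + 1 := ⟨j - t - 1, by omega⟩
  have h1 : (i : ℤ) - t = ((a + 1 : ℕ) : ℤ) := by omega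
  have h2 : (j : ℤ) - t = ((b + 1 : ℕ) : ℤ) := by omega
  rw [h1, h2, ha, hb', RSK, RSKaux_eq x' hpos r s _ _ _ a b (by omega) (by omega)]
  · congr 1
    omega
  · intro a b ha hb
    rw [phiInv_eq_pathWt x (by omega), pathWt_congr (hagree _ _ ha hb)]

end Paper
end

section
/- Let R = [r] × [s] and let x, x' ∈ ℝ_{>0}^R. Suppose that w_I^{(1)}(x) = w_I^{(1)}(x') for every interval I of R of the form [1,r] × [u,v] with 1 ≤ u ≤ v ≤ s, and for every interval I of the form [u,v] × [1,s] with 1 ≤ u ≤ v ≤ r. Then x = x'; that is, these chain sums uniquely determine the labeling. -/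
namespace Paper

/-- The saturated chains from `a` to `b`. -/
def saturatedChains (a b : ℤ × ℤ) : Set (List (ℤ × ℤ)) :=
  {l | l.IsChain CoverStep ∧ l.head? = some a ∧ l.getLast? = some b}

/-- The total weight of the saturated chains from `a` to `b`. -/
noncomputable def chainSum (x : ℤ × ℤ → ℝ) (a b : ℤ × ℤ) : ℝ :=
  ∑ᶠ l ∈ saturatedChains a b, (l.map x).prod

theorem mem_saturatedChains_iff {a b : ℤ × ℤ} {l : List (ℤ × ℤ)} :
    l ∈ saturatedChains a b ↔ (l = [a] ∧ a = b) ∨ ∃ m, a :: m = l ∧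
      (m ∈ saturatedChains (a.1 + 1, a.2) b ∨ m ∈ saturatedChains (a.1, a.2 + 1) b) := by
  rcases l with _ | ⟨c, _ | ⟨d, l⟩⟩
  · simp [saturatedChains]
  · simp only [saturatedChains, Set.mem_ofPred_eq]
    constructor
    · rintro ⟨-, h1, h2⟩
      simp_all
    · rintro (⟨h1, h2⟩ | ⟨m, h1, h2⟩)
      · simp_all
      · simp_all
  · simp only [saturatedChains, Set.mem_ofPred_eq, List.isChain_cons_cons, CoverStep]
    constructor
    · rintro ⟨⟨h, hc⟩, h1, h2⟩
      refine Or.inr ⟨d :: l, by simp_all, ?_⟩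
      simp only [List.head?_cons, Option.some.injEq] at h1
      subst h1
      rcases h with h | h
      · exact Or.inl ⟨hc, by simp [← h.1, ← h.2], by simpa using h2⟩
      · exact Or.inr ⟨hc, by simp [← h.1, ← h.2], by simpa using h2⟩
    · rintro (⟨h1, h2⟩ | ⟨m, h1, h2⟩)
      · simp_all
      · simp only [List.cons.injEq] at h1
        obtain ⟨rfl, rfl⟩ := h1
        rcases h2 with ⟨h, h1, h2⟩ | ⟨h, h1, h2⟩ <;>
          simp_all

theorem bounds_of_mem_saturatedChains {l : List (ℤ × ℤ)} {a b : ℤ × ℤ}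
    (hl : l ∈ saturatedChains a b) :
    ∀ v ∈ l, a.1 ≤ v.1 ∧ v.1 ≤ b.1 ∧ a.2 ≤ v.2 ∧ v.2 ≤ b.2 := by
  induction l generalizing a with
  | nil => simp
  | cons c l ih =>
    have key : a.1 ≤ b.1 ∧ a.2 ≤ b.2 ∧ c = a ∧
        ∀ v ∈ l, a.1 ≤ v.1 ∧ v.1 ≤ b.1 ∧ a.2 ≤ v.2 ∧ v.2 ≤ b.2 := by
      rcases mem_saturatedChains_iff.1 hl with ⟨h, rfl⟩ | ⟨m, h, h'⟩
      · simp_all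
      · simp only [List.cons.injEq] at h
        obtain ⟨rfl, rfl⟩ := h
        rcases h' with h' | h'
        all_goals
          have hb := ih h'
          have hm := hb _ (List.mem_of_mem_head? h'.2.1)
          simp only at hb hm
          refine ⟨by lia, by lia, rfl, fun v hv => ?_⟩
          have := hb v hv
          lia
    obtain ⟨h1, h2, rfl, h3⟩ := key
    intro v hv
    rcases List.mem_cons.1 hv with rfl | hv
    · exact ⟨le_rfl, h1, le_rfl, h2⟩
    · exact h3 v hv

theorem saturatedChains_eq_empty {a b : ℤ × ℤ} (h : b.1 < a.1 ∨ b.2 < a.2) :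
    saturatedChains a b = ∅ := by
  refine Set.eq_empty_of_forall_notMem fun l hl => ?_
  have := bounds_of_mem_saturatedChains hl _ (List.mem_of_mem_head? hl.2.1)
  lia

theorem saturatedChains_eq (a b : ℤ × ℤ) :
    saturatedChains a b = {l | l = [a] ∧ a = b} ∪ (a :: ·) ''
      (saturatedChains (a.1 + 1, a.2) b ∪ saturatedChains (a.1, a.2 + 1) b) := by
  ext l
  rw [mem_saturatedChains_iff]
  simp only [Set.mem_union, Set.mem_ofPred_eq, Set.mem_image, and_comm]

/-- Induction on the starting point of a lattice path ending at or below `b`. -/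
theorem startInduction {b : ℤ × ℤ} {P : ℤ × ℤ → Prop}
    (base : ∀ a : ℤ × ℤ, b.1 < a.1 ∨ b.2 < a.2 → P a)
    (step : ∀ a : ℤ × ℤ, a.1 ≤ b.1 → a.2 ≤ b.2 →
      P (a.1 + 1, a.2) → P (a.1, a.2 + 1) → P a) (a : ℤ × ℤ) : P a := by
  suffices H : ∀ (n : ℕ) (a : ℤ × ℤ), b.1 + b.2 - a.1 - a.2 < n → P a from
    H (b.1 + b.2 - a.1 - a.2 + 1).toNat a (by lia)
  intro n
  induction n with
  | zero => exact fun a ha => base a (by lia)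
  | succ n ih =>
    intro a ha
    by_cases h : b.1 < a.1 ∨ b.2 < a.2
    · exact base a h
    · exact step a (by lia) (by lia) (ih _ (by push_cast at ha; simp only; lia))
        (ih _ (by push_cast at ha; simp only; lia))

theorem finite_saturatedChains (a b : ℤ × ℤ) : (saturatedChains a b).Finite := by
  induction a using startInduction (b := b) with
  | base a h => simp [saturatedChains_eq_empty h]
  | step a _ _ h1 h2 =>
    rw [saturatedChains_eq]
    exact ((Set.finite_singleton [a]).subset fun l hl => hl.1).union ((h1.union h2).image _)

theorem chainSum_eq_zero (x : ℤ × ℤ → ℝ) {a b : ℤ × ℤ} (h : b.1 < a.1 ∨ b.2 < a.2) :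
    chainSum x a b = 0 := by
  simp [chainSum, saturatedChains_eq_empty h]

theorem chainSum_eq (x : ℤ × ℤ → ℝ) (a b : ℤ × ℤ) :
    chainSum x a b = x a * (chainSum x (a.1 + 1, a.2) b + chainSum x (a.1, a.2 + 1) b +
      if a = b then 1 else 0) := by
  have hfin := fun p : ℤ × ℤ => finite_saturatedChains p b
  have hinj : Function.Injective (fun l : List (ℤ × ℤ) => a :: l) := List.cons_injective
  rw [chainSum, saturatedChains_eq, finsum_mem_union, finsum_mem_image hinj.injOn]
  · simp only [List.map_cons, List.prod_cons]
    rw [← mul_finsum_mem, finsum_mem_union _ (hfin _) (hfin _)]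
    · change _ + x a * (chainSum x (a.1 + 1, a.2) b + chainSum x (a.1, a.2 + 1) b) = _
      by_cases hab : a = b
      · simp [hab]
        ring
      · simp [hab]
    · refine Set.disjoint_left.2 fun l h1 h2 => ?_
      have := h1.2.1.symm.trans h2.2.1
      simp at this
  · refine Set.disjoint_left.2 ?_
    rintro _ ⟨rfl, h⟩ ⟨m, hm, h'⟩
    simp only [List.cons.injEq, true_and] at h'
    subst h'
    rcases hm with hm | hm <;> simpa using hm.2.1
  · exact (Set.finite_singleton [a]).subset fun l hl => hl.1
  · exact ((hfin _).union (hfin _)).image _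

theorem w_one_eq_chainSum (i₁ i₂ j₁ j₂ : ℤ) (x : ℤ × ℤ → ℝ) :
    w i₁ i₂ j₁ j₂ 1 x = chainSum x (i₁, j₁) (i₂, j₂) := by
  rw [w, if_neg (by lia), chainSum, ← finsum_set_coe_eq_finsum_mem]
  have hmem : ∀ L : RSys i₁ i₂ j₁ j₂ (Int.toNat 1),
      L.path ⟨0, by decide⟩ ∈ saturatedChains (i₁, j₁) (i₂, j₂) := fun L =>
    ⟨L.chain _, by simpa using L.first ⟨0, by decide⟩, by simpa using L.final ⟨0, by decide⟩⟩
  refine finsum_eq_of_bijective (fun L => ⟨L.path ⟨0, by decide⟩, hmem L⟩) ⟨?_, ?_⟩ ?_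
  · rintro ⟨p, _, _, _, _, _⟩ ⟨q, _, _, _, _, _⟩ h
    simp only [Subtype.mk.injEq] at h
    have : p = q := by
      ext1 t
      rw [show t = ⟨0, by decide⟩ from Fin.ext (by have := t.2; simp at this; lia)]
      exact h
    subst this
    rfl
  · rintro ⟨l, hl⟩
    have h0 : ∀ t : Fin (Int.toNat 1), (t : ℕ) = 0 := fun t => by
      have := t.2
      simp at this
      lia
    exact ⟨⟨fun _ => l, fun _ => hl.1, fun _ => bounds_of_mem_saturatedChains hl,
      fun t => by simpa [h0] using hl.2.1, fun t => by simpa [h0] using hl.2.2,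
      fun t t' h => absurd (Fin.ext (by rw [h0, h0])) h⟩, rfl⟩
  · intro L
    exact Fin.prod_univ_one (fun t : Fin 1 => ((L.path t).map x).prod)

theorem chainSum_swap (x : ℤ × ℤ → ℝ) (a b : ℤ × ℤ) :
    chainSum (x ∘ Prod.swap) a.swap b.swap = chainSum x a b := by
  induction a using startInduction (b := b) with
  | base a h => rw [chainSum_eq_zero x h, chainSum_eq_zero _ (by simpa using h.symm)]
  | step a _ _ h1 h2 =>
    simp only [Prod.swap_prod_mk] at h1 h2
    rw [chainSum_eq x a b, chainSum_eq _ a.swap, ← h1, ← h2]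
    simp only [Prod.fst_swap, Prod.snd_swap, Function.comp_apply, Prod.swap_swap,
      Prod.swap_inj]
    ring

theorem chainSum_pos {x : ℤ × ℤ → ℝ} {r s : ℕ} (hx : ∀ p, inR r s p → 0 < x p) {a : ℤ × ℤ}
    (ha : inR r s a) : 0 < chainSum x a (r, s) := by
  induction a using startInduction (b := ((r : ℤ), (s : ℤ))) with
  | base a h =>
    simp only [inR] at ha h
    lia
  | step a h1 h2 ih1 ih2 =>
    rw [chainSum_eq]
    refine mul_pos (hx a ha) ?_
    simp only [inR] at ha h1 h2 ih1 ih2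
    rcases h1.eq_or_lt with h1 | h1
    · rw [chainSum_eq_zero x (a := (a.1 + 1, a.2)) (Or.inl (by simp only; lia))]
      rcases h2.eq_or_lt with h2 | h2
      · rw [chainSum_eq_zero x (Or.inr (by simp only; lia)), if_pos (Prod.ext h1 h2)]
        norm_num
      · have := ih2 (by lia)
        rw [if_neg (by rintro rfl; simp at h2)]
        linarith
    · have := ih1 (by lia)
      rw [if_neg (by rintro rfl; simp at h1)]
      rcases h2.eq_or_lt with h2 | h2
      · rw [chainSum_eq_zero x (a := (a.1, a.2 + 1)) (Or.inr (by simp only; lia))]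
        linarith
      · have := ih2 (by lia)
        linarith

/-- The labels bumped out of `x` by one step of geometric row insertion: with `f p` the chain
sum from `p` to `c`, this is the parallel sum of the values of `f` at the two upper covers of
`p`, divided by `f (p + (1, 1))`. -/
noncomputable def bumped (c : ℤ × ℤ) (x : ℤ × ℤ → ℝ) (p : ℤ × ℤ) : ℝ :=
  chainSum x (p.1 + 1, p.2) c * chainSum x (p.1, p.2 + 1) c /
    (chainSum x (p.1 + 1, p.2 + 1) c *
      (chainSum x (p.1 + 1, p.2) c + chainSum x (p.1, p.2 + 1) c))

theorem bumped_swap (c : ℤ × ℤ) (x : ℤ × ℤ → ℝ) :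
    bumped c.swap (x ∘ Prod.swap) = bumped c x ∘ Prod.swap := by
  ext p
  simp only [bumped, Function.comp_apply, Prod.fst_swap, Prod.snd_swap, ← chainSum_swap x,
    Prod.swap_prod_mk]
  ring

theorem bumped_pos {x : ℤ × ℤ → ℝ} {r s : ℕ} (hx : ∀ p, inR (r + 1) (s + 1) p → 0 < x p)
    {p : ℤ × ℤ} (hp : inR r s p) : 0 < bumped ((r + 1 : ℕ), (s + 1 : ℕ)) x p := by
  simp only [inR] at hp
  have h1 : 0 < chainSum x (p.1 + 1, p.2) ((r + 1 : ℕ), (s + 1 : ℕ)) :=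
    chainSum_pos hx (by simp only [inR]; lia)
  have h2 : 0 < chainSum x (p.1, p.2 + 1) ((r + 1 : ℕ), (s + 1 : ℕ)) :=
    chainSum_pos hx (by simp only [inR]; lia)
  have h3 : 0 < chainSum x (p.1 + 1, p.2 + 1) ((r + 1 : ℕ), (s + 1 : ℕ)) :=
    chainSum_pos hx (by simp only [inR]; lia)
  rw [bumped]
  positivity

/-- A two-path determinant in `x` equals a chain sum of the bumped labeling; the last summand
accounts for the row of starting points not covered by the latter. -/
theorem chainSum_bumped_add_ite {x : ℤ × ℤ → ℝ} {r s : ℕ}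
    (hx : ∀ p, inR (r + 1) (s + 1) p → 0 < x p) {v : ℤ} (hv : v ≤ s) (a : ℤ × ℤ)
    (ha : inR (r + 1) s a) :
    chainSum x a ((r + 1 : ℕ), v) * chainSum x (a.1, a.2 + 1) ((r + 1 : ℕ), (s + 1 : ℕ)) /
        chainSum x a ((r + 1 : ℕ), (s + 1 : ℕ)) - chainSum x (a.1, a.2 + 1) ((r + 1 : ℕ), v) =
      chainSum (bumped ((r + 1 : ℕ), (s + 1 : ℕ)) x) a (r, v) +
        if a = (((r + 1 : ℕ) : ℤ), v) then 1 else 0 := by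
  set c : ℤ × ℤ := ((r + 1 : ℕ), (s + 1 : ℕ)) with hc
  have hc1 : c.1 = r + 1 := by simp [hc]
  have hc2 : c.2 = s + 1 := by simp [hc]
  set b : ℤ × ℤ := ((r + 1 : ℕ), v) with hb
  have hb1 : b.1 = r + 1 := by simp [hb]
  have hb2 : b.2 = v := rfl
  set y := bumped c x with hy
  have hpos : ∀ p : ℤ × ℤ, 1 ≤ p.1 → p.1 ≤ r + 1 → 1 ≤ p.2 → p.2 ≤ s + 1 →
      0 < chainSum x p c := fun p _ _ _ _ =>
    chainSum_pos hx (by simp only [inR]; lia)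
  induction a using startInduction (b := ((r + 1 : ℤ), (s : ℤ))) with
  | base a h =>
    simp only [inR] at ha h
    lia
  | step a h1 h2 ih1 ih2 =>
    have hxa : 0 < x a := hx a (by simp only [inR] at ha ⊢; lia)
    simp only [inR] at ha h1 h2 ih1 ih2
    have hf : 0 < chainSum x a c := hpos a (by lia) (by lia) (by lia) (by lia)
    have hfr : 0 < chainSum x (a.1, a.2 + 1) c :=
      hpos _ (by simp only; lia) (by simp only; lia) (by simp only; lia) (by simp only; lia)
    have hfeq := chainSum_eq x a c
    rw [if_neg (fun h => by rw [h] at h2; lia), add_zero] at hfeq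
    have haeq := chainSum_eq x a b
    rcases h1.eq_or_lt with h1 | h1
    · rw [chainSum_eq_zero x (a := (a.1 + 1, a.2)) (Or.inl (by simp only; lia)), zero_add]
        at hfeq haeq
      rw [chainSum_eq_zero y (Or.inl (by simp only; lia)), haeq, hfeq]
      field_simp
      ring
    · have hab : a ≠ b := fun h => by rw [h] at h1; lia
      rw [if_neg hab, add_zero] at haeq
      have hfd : 0 < chainSum x (a.1 + 1, a.2) c :=
        hpos _ (by simp only; lia) (by simp only; lia) (by simp only; lia) (by simp only; lia)
      have hfdr : 0 < chainSum x (a.1 + 1, a.2 + 1) c :=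
        hpos _ (by simp only; lia) (by simp only; lia) (by simp only; lia) (by simp only; lia)
      have hd := ih1 (by lia)
      have hr : chainSum x (a.1, a.2 + 1) b * chainSum x (a.1, a.2 + 1 + 1) c /
          chainSum x (a.1, a.2 + 1) c - chainSum x (a.1, a.2 + 1 + 1) b =
          chainSum y (a.1, a.2 + 1) (r, v) := by
        rcases h2.eq_or_lt with h2 | h2
        · rw [chainSum_eq_zero x (a := (a.1, a.2 + 1)) (b := b) (Or.inr (by simp only; lia)),
            chainSum_eq_zero x (a := (a.1, a.2 + 1 + 1)) (b := b)
              (Or.inr (by simp only; lia)),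
            chainSum_eq_zero y (Or.inr (by simp only; lia))]
          simp
        · have := ih2 (by lia)
          rwa [if_neg (fun h => by have := congrArg Prod.fst h; simp only at this; lia),
            add_zero] at this
      have hxr : 0 < x (a.1, a.2 + 1) := hx _ (by simp only [inR]; lia)
      have hreq := chainSum_eq x (a.1, a.2 + 1) b
      have hfreq := chainSum_eq x (a.1, a.2 + 1) c
      rw [if_neg (fun h => by have := congrArg Prod.fst h; simp only at this; lia),
        add_zero] at hreq hfreq
      have hδ : (if (a.1 + 1, a.2) = b then (1 : ℝ) else 0) = if a = (↑r, v) then 1 else 0 := by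
        congr 1
        simp only [hb, Prod.ext_iff, Nat.cast_add, Nat.cast_one, add_left_inj]
      have hyeq := chainSum_eq y a (r, v)
      rw [← hr, add_right_comm, ← hδ, ← hd] at hyeq
      have hya : y a = chainSum x (a.1 + 1, a.2) c * chainSum x (a.1, a.2 + 1) c /
        (chainSum x (a.1 + 1, a.2 + 1) c *
          (chainSum x (a.1 + 1, a.2) c + chainSum x (a.1, a.2 + 1) c)) := rfl
      rw [if_neg hab, add_zero, hyeq, hya, haeq, hfeq]
      simp only at hreq hfreq ⊢
      clear_value y b c
      generalize chainSum x (a.1 + 1, a.2) c = fd at *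
      generalize chainSum x (a.1, a.2 + 1) c = fr at *
      generalize chainSum x (a.1 + 1, a.2 + 1) c = fdr at *
      generalize chainSum x (a.1, a.2 + 1 + 1) c = frr at *
      generalize chainSum x (a.1 + 1, a.2) b = ad at *
      generalize chainSum x (a.1, a.2 + 1) b = ar at *
      generalize chainSum x (a.1 + 1, a.2 + 1) b = adr at *
      generalize chainSum x (a.1, a.2 + 1 + 1) b = arr at *
      generalize x (a.1, a.2 + 1) = z at *
      have hfrr : frr = fr / z - fdr := by rw [hfreq]; field_simp; ring
      have harr : arr = ar / z - adr := by rw [hreq]; field_simp; ring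
      rw [hfrr, harr]
      field_simp
      ring

/-- The chain sums of the bumped labeling over full-height strips are determined by those of
the original labeling. -/
theorem chainSum_bumped {x : ℤ × ℤ → ℝ} {r s : ℕ}
    (hx : ∀ p, inR (r + 1) (s + 1) p → 0 < x p) {i u v : ℤ} (hi : 1 ≤ i) (hir : i ≤ r)
    (hu : 1 ≤ u) (huv : u ≤ v) (hv : v ≤ s) :
    chainSum (bumped ((r + 1 : ℕ), (s + 1 : ℕ)) x) (i, u) (r, v) =
      chainSum x (i, u) ((r + 1 : ℕ), v) * chainSum x (i, u + 1) ((r + 1 : ℕ), (s + 1 : ℕ)) /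
        chainSum x (i, u) ((r + 1 : ℕ), (s + 1 : ℕ)) - chainSum x (i, u + 1) ((r + 1 : ℕ), v) := by
  rw [chainSum_bumped_add_ite hx hv (i, u) (by simp only [inR]; lia),
    if_neg (fun h => by have := congrArg Prod.fst h; simp at this; lia), add_zero]

theorem eq_of_chainSum_eq (r s : ℕ) (x x' : ℤ × ℤ → ℝ)
    (hx : ∀ p, inR r s p → 0 < x p) (hx' : ∀ p, inR r s p → 0 < x' p)
    (hcol : ∀ u v : ℤ, 1 ≤ u → u ≤ v → v ≤ s →
      chainSum x (1, u) (r, v) = chainSum x' (1, u) (r, v))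
    (hrow : ∀ u v : ℤ, 1 ≤ u → u ≤ v → v ≤ r →
      chainSum x (u, 1) (v, s) = chainSum x' (u, 1) (v, s)) :
    ∀ p, inR r s p → x p = x' p := by
  induction r generalizing s x x' with
  | zero =>
    intro p hp
    simp only [inR] at hp
    lia
  | succ r ih =>
  cases s with
  | zero =>
    intro p hp
    simp only [inR] at hp
    lia
  | succ s =>
  set c : ℤ × ℤ := ((r + 1 : ℕ), (s + 1 : ℕ)) with hc
  have hswap : ∀ {z : ℤ × ℤ → ℝ}, (∀ p, inR (r + 1) (s + 1) p → 0 < z p) →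
      ∀ p, inR (s + 1) (r + 1) p → 0 < (z ∘ Prod.swap) p := fun h p hp =>
    h _ (by simp only [inR, Prod.fst_swap, Prod.snd_swap] at hp ⊢; lia)
  have hcol' : ∀ u v : ℤ, 1 ≤ u → v ≤ (s + 1 : ℕ) →
      chainSum x (1, u) ((r + 1 : ℕ), v) = chainSum x' (1, u) ((r + 1 : ℕ), v) :=
    fun u v h1 h2 => by
      rcases le_or_gt u v with h | h
      · exact hcol u v h1 h h2
      · rw [chainSum_eq_zero x (Or.inr h), chainSum_eq_zero x' (Or.inr h)]
  have hrow' : ∀ u v : ℤ, 1 ≤ u → v ≤ (r + 1 : ℕ) →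
      chainSum (x ∘ Prod.swap) (1, u) ((s + 1 : ℕ), v) =
        chainSum (x' ∘ Prod.swap) (1, u) ((s + 1 : ℕ), v) := fun u v h1 h2 => by
    rcases le_or_gt u v with h | h
    · have := hrow u v h1 h h2
      rwa [← chainSum_swap x, ← chainSum_swap x'] at this
    · rw [chainSum_eq_zero _ (Or.inr h), chainSum_eq_zero _ (Or.inr h)]
  have hy : ∀ p, inR r s p → bumped c x p = bumped c x' p := by
    refine ih s _ _ (fun p => bumped_pos hx) (fun p => bumped_pos hx') ?_ ?_
    · intro u v hu huv hv
      rcases Nat.eq_zero_or_pos r with rfl | hr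
      · simp [chainSum_eq_zero]
      rw [chainSum_bumped hx le_rfl (by lia) hu huv hv,
        chainSum_bumped hx' le_rfl (by lia) hu huv hv]
      rw [hcol', hcol', hcol', hcol'] <;> lia
    · intro u v hu huv hv
      rcases Nat.eq_zero_or_pos s with rfl | hs
      · simp [chainSum_eq_zero]
      rw [← chainSum_swap (bumped c x), ← chainSum_swap (bumped c x'), ← bumped_swap,
        ← bumped_swap]
      simp only [hc, Prod.swap_prod_mk]
      rw [chainSum_bumped (hswap hx) le_rfl (by lia) hu huv hv,
        chainSum_bumped (hswap hx') le_rfl (by lia) hu huv hv]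
      rw [hrow', hrow', hrow', hrow'] <;> lia
  have hf : ∀ (m n : ℕ), m ≤ r → n ≤ s →
      chainSum x (m + 1, n + 1) c = chainSum x' (m + 1, n + 1) c := by
    intro m
    induction m with
    | zero =>
      intro n _ hn
      simpa [hc] using hcol (n + 1) (s + 1 : ℕ) (by lia) (by lia) (by lia)
    | succ m ihm =>
      intro n
      induction n with
      | zero =>
        intro hm _
        simpa [hc] using hrow ((m + 1 : ℕ) + 1) (r + 1 : ℕ) (by lia) (by lia) (by lia)
      | succ n ihn =>
        intro hm hn
        have hd := ihn hm (by lia)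
        have hr := ihm (n + 1) (by lia) hn
        have h := hy (m + 1, n + 1) (by simp only [inR]; lia)
        have p1 : 0 < chainSum x ((m + 1 : ℕ) + 1, n + 1) c :=
          chainSum_pos hx (by simp only [inR]; lia)
        have p2 : 0 < chainSum x (m + 1, (n + 1 : ℕ) + 1) c :=
          chainSum_pos hx (by simp only [inR]; lia)
        have p3 : 0 < chainSum x ((m + 1 : ℕ) + 1, (n + 1 : ℕ) + 1) c :=
          chainSum_pos hx (by simp only [inR]; lia)
        have p4 : 0 < chainSum x' ((m + 1 : ℕ) + 1, (n + 1 : ℕ) + 1) c :=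
          chainSum_pos hx' (by simp only [inR]; lia)
        simp only [bumped] at h
        push_cast at *
        rw [← hd, ← hr] at h
        field_simp at h
        exact h.symm
  have hf' : ∀ p : ℤ × ℤ, 1 ≤ p.1 → 1 ≤ p.2 → chainSum x p c = chainSum x' p c := by
    intro p h1 h2
    by_cases h : c.1 < p.1 ∨ c.2 < p.2
    · rw [chainSum_eq_zero x h, chainSum_eq_zero x' h]
    · simp only [hc] at h
      have := hf (p.1 - 1).toNat (p.2 - 1).toNat (by lia) (by lia)
      rwa [show (((p.1 - 1).toNat : ℤ) + 1, ((p.2 - 1).toNat : ℤ) + 1) = p from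
        Prod.ext (by simp only; lia) (by simp only; lia)] at this
  intro p hp
  have h0 : 0 < chainSum x p c := chainSum_pos hx hp
  simp only [inR] at hp
  have h := hf' p (by lia) (by lia)
  have h1 := chainSum_eq x p c
  have h2 := chainSum_eq x' p c
  rw [← h, ← hf' _ (by simp only; lia) (by simp only; lia),
    ← hf' _ (by simp only; lia) (by simp only; lia)] at h2
  have hne := (ne_of_gt h0)
  rw [h1] at hne
  exact mul_right_cancel₀ (right_ne_zero_of_mul hne) (h1.symm.trans h2)

/-- **Theorem 5.6.** The chain sums `w_I^{(1)}`, where `I` ranges over intervals of the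
form `[1,r] × [u,v]` and `[u,v] × [1,s]`, uniquely determine a positive labeling of
`R = [r] × [s]`. -/
theorem chain_sums_determine_labeling (r s : ℕ) (hr : 1 ≤ r) (hs : 1 ≤ s)
    (x x' : ℤ × ℤ → ℝ)
    (hx : ∀ p, inR r s p → 0 < x p) (hx' : ∀ p, inR r s p → 0 < x' p)
    (hcol : ∀ u v : ℤ, 1 ≤ u → u ≤ v → v ≤ (s : ℤ) →
      w 1 r u v 1 x = w 1 r u v 1 x')
    (hrow : ∀ u v : ℤ, 1 ≤ u → u ≤ v → v ≤ (r : ℤ) →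
      w u v 1 s 1 x = w u v 1 s 1 x') :
    ∀ p, inR r s p → x p = x' p := by
  simp only [w_one_eq_chainSum] at hcol hrow
  exact eq_of_chainSum_eq r s x x' hx hx' hcol hrow

end Paper
end
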